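/- Let ε > 0 and let G be a finite (1+ε)-tough 5-chordal graph that is 3-connected, such that for every 3 mutually remote edges e₁, e₂, e₃ of G, d(e₁) + d(e₂) + d(e₃) > (3/2)·(|V(G)| − 3). Then G is prism-Hamiltonian. -/

import Mathlib

open SimpleGraph Finset

variable {V : Type*}

/-- `G` is `β`-tough: whenever removing a vertex set `S` leaves at least two connected
components, we have `β * (number of components) ≤ |S|`. -/
def IsTough [Fintype V] (β : ℝ) (G : SimpleGraph V) : Prop :=
  ∀ S : Finset V,
    2 ≤ Nat.card (G.induce ((S : Set V)ᶜ)).ConnectedComponent →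
    β * Nat.card (G.induce ((S : Set V)ᶜ)).ConnectedComponent ≤ S.card

/-- A chord of a closed walk `c` in `G`: an edge of `G` between two vertices of `c`
which is not an edge of `c` (hence joins non-consecutive vertices of a cycle). -/
def HasChord (G : SimpleGraph V) {u : V} (c : G.Walk u u) : Prop :=
  ∃ x y : V, x ∈ c.support ∧ y ∈ c.support ∧ G.Adj x y ∧ s(x, y) ∉ c.edges

/-- `G` is 5-chordal: every cycle of length at least 5 has a chord. -/
def FiveChordal (G : SimpleGraph V) : Prop :=
  ∀ (u : V) (c : G.Walk u u), c.IsCycle → 5 ≤ c.length → HasChord G c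

/-- A cycle `c` is edge-dominating in `G` if the induced subgraph on the vertices
outside of `c` contains no edge. -/
def IsEdgeDominating (G : SimpleGraph V) {u : V} (c : G.Walk u u) : Prop :=
  ∀ x y : V, x ∉ c.support → y ∉ c.support → ¬ G.Adj x y

/-- `G` is prism-Hamiltonian if the Cartesian (box) product of `G` with `K₂`
has a Hamiltonian cycle. -/
def PrismHamiltonian [Fintype V] [DecidableEq V] (G : SimpleGraph V) : Prop :=
  (G □ (⊤ : SimpleGraph (Fin 2))).IsHamiltonian

/-- `G` is `k`-connected: `G` has more than `k` vertices and removing any set of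
fewer than `k` vertices leaves a connected graph. -/
def KConnected [Fintype V] (k : ℕ) (G : SimpleGraph V) : Prop :=
  k < Fintype.card V ∧
    ∀ S : Finset V, S.card < k → (G.induce ((S : Set V)ᶜ)).Connected

/-- The degree `d(e)` of an edge `e = uv`: the number of vertices other than `u, v`
adjacent to `u` or `v`. -/
noncomputable def edgeDeg (G : SimpleGraph V) (u v : V) : ℕ :=
  ((G.neighborSet u ∪ G.neighborSet v) \ {u, v}).ncard

/-- Two edges (given by their endpoints) are remote: they are vertex-disjoint and
no edge of `G` joins an endpoint of one to an endpoint of the other. -/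
def Remote (G : SimpleGraph V) (e₁ e₂ : V × V) : Prop :=
  e₁.1 ≠ e₂.1 ∧ e₁.1 ≠ e₂.2 ∧ e₁.2 ≠ e₂.1 ∧ e₁.2 ≠ e₂.2 ∧
  ¬ G.Adj e₁.1 e₂.1 ∧ ¬ G.Adj e₁.1 e₂.2 ∧ ¬ G.Adj e₁.2 e₂.1 ∧ ¬ G.Adj e₁.2 e₂.2

/-- The list `l` is a nonempty walk of `G` from `x` to `y`. -/
def ListWalk (G : SimpleGraph V) (l : List V) (x y : V) : Prop :=
  l.IsChain G.Adj ∧ x ∈ l.head? ∧ y ∈ l.getLast?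

namespace ListWalk

variable {G : SimpleGraph V} {l l' : List V} {x y x' y' : V}

theorem singleton (x : V) : ListWalk G [x] x x := by simp [ListWalk]

theorem append (h : ListWalk G l x y) (h' : ListWalk G l' x' y') (ha : G.Adj y x') :
    ListWalk G (l ++ l') x y' := by
  obtain ⟨h1, h2, h3⟩ := h
  obtain ⟨h1', h2', h3'⟩ := h'
  refine ⟨h1.append h1' ?_, ?_, ?_⟩
  · intro u hu v hv
    rw [Option.mem_unique hu h3, Option.mem_unique hv h2']
    exact ha
  · simp [Option.mem_def.1 h2]
  · simp [Option.mem_def.1 h3']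

theorem cons (h : ListWalk G l x y) (ha : G.Adj x' x) : ListWalk G (x' :: l) x' y :=
  (singleton x').append h ha

theorem concat (h : ListWalk G l x y) (ha : G.Adj y y') : ListWalk G (l ++ [y']) x y' :=
  h.append (singleton y') ha

theorem reverse (h : ListWalk G l x y) : ListWalk G l.reverse y x := by
  obtain ⟨h1, h2, h3⟩ := h
  refine ⟨?_, by simpa using h3, by simpa using h2⟩
  rw [List.isChain_reverse]
  exact h1.imp fun _ _ h => h.symm

theorem map {W : Type*} {H : SimpleGraph W} {f : V → W} (hf : ∀ u v, G.Adj u v → H.Adj (f u) (f v))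
    (h : ListWalk G l x y) : ListWalk H (l.map f) (f x) (f y) := by
  obtain ⟨h1, h2, h3⟩ := h
  refine ⟨List.isChain_map_of_isChain f hf h1, ?_, ?_⟩
  · simp [Option.mem_def.1 h2]
  · simp [Option.mem_def.1 h3]

theorem ne_nil (h : ListWalk G l x y) : l ≠ [] := by
  rintro rfl; simp [ListWalk] at h

theorem left_mem (h : ListWalk G l x y) : x ∈ l := List.mem_of_mem_head? h.2.1

theorem right_mem (h : ListWalk G l x y) : y ∈ l := List.mem_of_mem_getLast? h.2.2

theorem eq_cons (h : ListWalk G l x y) : ∃ t, l = x :: t := by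
  cases l with
  | nil => exact absurd rfl h.ne_nil
  | cons a t => exact ⟨t, by have := h.2.1; simp at this; rw [this]⟩

theorem eq_concat (h : ListWalk G l x y) : ∃ t, l = t ++ [y] := by
  obtain ⟨t, ht⟩ := h.reverse.eq_cons
  exact ⟨t.reverse, by rw [← List.reverse_reverse l, ht]; simp⟩

/-- Splitting a walk at a place where both parts are nonempty. -/
theorem split (h : ListWalk G (l ++ l') x y) (hl : l ≠ []) (hl' : l' ≠ []) :
    ∃ u v, ListWalk G l x u ∧ ListWalk G l' v y ∧ G.Adj u v := by
  obtain ⟨h1, h2, h3⟩ := h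
  refine ⟨l.getLast hl, l'.head hl', ⟨h1.left_of_append, ?_, ?_⟩, ⟨h1.right_of_append, ?_, ?_⟩,
    h1.rel_getLast_head_of_append hl hl'⟩
  · cases l <;> simp_all
  · simp [List.getLast?_eq_getLast_of_ne_nil hl]
  · simp [List.head?_eq_some_head hl']
  · simpa [List.getLast?_append_of_ne_nil _ hl'] using h3

theorem tail (h : ListWalk G (x :: y' :: l) x y) : ListWalk G (y' :: l) y' y ∧ G.Adj x y' := by
  obtain ⟨h1, h2, h3⟩ := h
  rw [List.isChain_cons_cons] at h1
  exact ⟨⟨h1.2, by simp, by simpa using h3⟩, h1.1⟩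

theorem exists_walk (h : ListWalk G l x y) : ∃ p : G.Walk x y, p.support = l := by
  obtain ⟨h1, h2, h3⟩ := h
  have hne : l ≠ [] := by rintro rfl; simp at h2
  have e1 : l.head hne = x := by simpa [List.head?_eq_some_head hne] using h2
  have e2 : l.getLast hne = y := by simpa [List.getLast?_eq_getLast_of_ne_nil hne] using h3
  subst e1 e2
  exact ⟨Walk.ofSupport l hne h1, by simp⟩

theorem of_walk (p : G.Walk x y) : ListWalk G p.support x y := by
  refine ⟨p.isChain_adj_support, ?_, ?_⟩
  · cases p <;> simp
  · simp [List.getLast?_eq_getLast_of_ne_nil p.support_ne_nil]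

theorem exists_isCycle [DecidableEq V] (h : ListWalk G l x y) (ha : G.Adj y x) (hl : l.Nodup)
    (h3 : 3 ≤ l.length) : ∃ c : G.Walk y y, c.IsCycle ∧ c.support = y :: l := by
  obtain ⟨p, rfl⟩ := h.exists_walk
  refine ⟨.cons ha p, ?_, by simp⟩
  rw [Walk.isCycle_iff_isPath_tail_and_le_length]
  refine ⟨?_, by simpa using h3⟩
  rw [Walk.isPath_def]
  simpa using hl

theorem isHamiltonian [Fintype V] [DecidableEq V] (h : ListWalk G l x y) (ha : G.Adj y x)
    (hl : l.Nodup) (h3 : 3 ≤ l.length) (hc : ∀ v, v ∈ l) : G.IsHamiltonian := by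
  intro _
  obtain ⟨c, hc1, hc2⟩ := h.exists_isCycle ha hl h3
  refine ⟨y, c, ?_⟩
  rw [Walk.isHamiltonianCycle_iff_isCycle_and_support_count_tail_eq_one]
  refine ⟨hc1, fun a => ?_⟩
  rw [hc2, List.tail_cons]
  exact List.count_eq_one_of_mem hl (hc a)

end ListWalk

section Prism

/-- Traverse each block `x :: hang x` on one level and back on the other one, alternating
the starting level. -/
def prismTour (hang : V → List V) : List V → Fin 2 → List (V × Fin 2)
  | [], _ => []
  | x :: C, s => (x :: hang x).map (·, s) ++ ((x :: hang x).map (·, 1 - s)).reverse ++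
      prismTour hang C (1 - s)

variable {G : SimpleGraph V} {hang : V → List V}

theorem mem_prismTour {C : List V} {s : Fin 2} {u : V × Fin 2} :
    u ∈ prismTour hang C s ↔ ∃ x ∈ C, u.1 ∈ x :: hang x := by
  obtain ⟨u, t⟩ := u
  induction C generalizing s with
  | nil => simp [prismTour]
  | cons x C ih =>
    have hts : t = s ∨ t = 1 - s := by omega
    rw [prismTour, List.mem_append, ih]
    have h1 : ∀ (l : List V) (r : Fin 2), (u, t) ∈ l.map (·, r) ↔ u ∈ l ∧ t = r := by
      simp [eq_comm, and_left_comm]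
    rw [List.mem_append, List.mem_reverse, h1, h1, ← and_or_left, and_iff_left hts]
    simp only [List.mem_cons, exists_eq_or_imp]

theorem nodup_prismTour {C : List V} (h : (C.flatMap fun x => x :: hang x).Nodup) (s : Fin 2) :
    (prismTour hang C s).Nodup := by
  induction C generalizing s with
  | nil => simp [prismTour]
  | cons x C ih =>
    rw [List.flatMap_cons, List.nodup_append] at h
    obtain ⟨h1, h2, h3⟩ := h
    have hinj : ∀ t : Fin 2, Function.Injective fun v : V => (v, t) :=
      fun t a b hab => by simpa using hab
    rw [prismTour, List.nodup_append, List.nodup_append]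
    refine ⟨⟨h1.map (hinj _), List.nodup_reverse.2 (h1.map (hinj _)), ?_⟩, ih h2 _, ?_⟩
    · intro a ha b hb hab
      rw [List.mem_map] at ha
      rw [List.mem_reverse, List.mem_map] at hb
      obtain ⟨_, _, rfl⟩ := ha
      obtain ⟨_, _, rfl⟩ := hb
      have := congrArg Prod.snd hab
      simp only at this
      omega
    · intro a ha b hb hab
      obtain ⟨z, hz, hz'⟩ := mem_prismTour.1 hb
      refine h3 a.1 ?_ b.1 (List.mem_flatMap.2 ⟨z, hz, hz'⟩) (by rw [hab])
      rw [List.mem_append, List.mem_reverse, List.mem_map, List.mem_map] at ha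
      rcases ha with ⟨w, hw, rfl⟩ | ⟨w, hw, rfl⟩ <;> exact hw

theorem ListWalk.prismTour {C : List V} {x y : V} (h : ListWalk G C x y)
    (hh : ∀ z ∈ C, (z :: hang z).IsChain G.Adj) (s : Fin 2) :
    ∃ t, (Even C.length ↔ t = s) ∧
      ListWalk (G □ (⊤ : SimpleGraph (Fin 2))) (prismTour hang C s) (x, s) (y, t) := by
  induction C generalizing s x with
  | nil => exact absurd rfl h.ne_nil
  | cons a C ih =>
    obtain rfl : a = x := by have := h.2.1; simpa using this
    have hs : s ≠ 1 - s := by omega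
    have key : ListWalk (G □ (⊤ : SimpleGraph (Fin 2)))
        ((a :: hang a).map (·, s) ++ ((a :: hang a).map (·, 1 - s)).reverse) (a, s) (a, 1 - s) := by
      have h1 : ListWalk G (a :: hang a) a ((a :: hang a).getLast (by simp)) :=
        ⟨hh a (by simp), by simp, by rw [List.getLast?_eq_getLast_of_ne_nil (by simp)]; simp⟩
      refine (h1.map (f := (·, s)) fun u v huv => ?_).append
        (h1.map (f := (·, 1 - s)) fun u v huv => ?_).reverse ?_
      · simp [boxProd_adj, huv]
      · simp [boxProd_adj, huv]
      · simp [boxProd_adj, hs]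
    cases C with
    | nil =>
      obtain rfl : a = y := by have := h.2.2; simpa using this
      exact ⟨1 - s, by simp [hs.symm], by simpa [_root_.prismTour] using key⟩
    | cons b C =>
      obtain ⟨h1, h2⟩ := h.tail
      obtain ⟨t, ht, hw⟩ := ih h1 (fun z hz => hh z (List.mem_cons_of_mem _ hz)) (1 - s)
      refine ⟨t, ?_, key.append hw (by simp [boxProd_adj, h2])⟩
      rw [List.length_cons, Nat.even_add_one, ht]
      omega

/-- An even cyclic sequence with disjoint paths hanging at its vertices, covering all vertices,
yields a Hamiltonian cycle of the prism. -/
theorem ListWalk.prismHamiltonian [Fintype V] [DecidableEq V] {C : List V} {x y : V}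
    (h : ListWalk G C x y) (ha : G.Adj y x) (he : Even C.length)
    (hh : ∀ z ∈ C, (z :: hang z).IsChain G.Adj)
    (hn : (C.flatMap fun x => x :: hang x).Nodup)
    (hc : ∀ v, ∃ z ∈ C, v ∈ z :: hang z) : PrismHamiltonian G := by
  obtain ⟨t, ht, hw⟩ := h.prismTour hh 0
  rw [ht.1 he] at hw
  refine hw.isHamiltonian (by simp [boxProd_adj, ha]) (nodup_prismTour hn 0) ?_
    (fun v => mem_prismTour.2 (hc v.1))
  obtain ⟨t, rfl⟩ := h.eq_cons
  cases t with
  | nil => simp at he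
  | cons b t => simp [_root_.prismTour]; omega

end Prism

/-- Hanging a path at one vertex and a matching at the others. -/
theorem ListWalk.prismHamiltonian_of_matching [Fintype V] [DecidableEq V] {G : SimpleGraph V}
    {D E : List V} {x y p : V} {J : Finset V} {f : V → V}
    (h : ListWalk G D x y) (ha : G.Adj y x) (he : Even D.length) (hD : D.Nodup)
    (hp : p ∈ D) (hE : (p :: E).IsChain G.Adj) (hE' : E.Nodup) (hDE : ∀ z ∈ E, z ∉ D)
    (hJE : ∀ z ∈ E, z ∉ J) (hJD : ∀ z ∈ J, z ∉ D) (hV : ∀ z, z ∈ D ∨ z ∈ E ∨ z ∈ J)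
    (hf : Set.InjOn f J) (hfD : ∀ j ∈ J, f j ∈ D ∧ f j ≠ p ∧ G.Adj (f j) j) :
    PrismHamiltonian G := by
  classical
  let hang : V → List V := fun z => if z = p then E else (J.filter (f · = z)).toList
  have hhp : hang p = E := by simp [hang]
  have hhz : ∀ z, z ≠ p → hang z = (J.filter (f · = z)).toList := fun z hz => by simp [hang, hz]
  have hsub : ∀ z w, w ∈ hang z → w ∉ D := by
    intro z w hw
    by_cases hz : z = p
    · subst hz; rw [hhp] at hw; exact hDE w hw
    · rw [hhz z hz] at hw
      exact hJD w (by simp at hw; exact hw.1)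
  have hsep : ∀ z z' w, w ∈ hang z → w ∈ hang z' → z = z' := by
    intro z z' w hw hw'
    by_cases hz : z = p <;> by_cases hz' : z' = p
    · rw [hz, hz']
    · subst hz; rw [hhp] at hw; rw [hhz z' hz'] at hw'
      exact absurd (by simp at hw'; exact hw'.1) (hJE w hw)
    · subst hz'; rw [hhp] at hw'; rw [hhz z hz] at hw
      exact absurd (by simp at hw; exact hw.1) (hJE w hw')
    · rw [hhz z hz] at hw; rw [hhz z' hz'] at hw'
      simp at hw hw'
      rw [← hw.2, hw'.2]
  refine h.prismHamiltonian (hang := hang) ha he ?_ ?_ ?_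
  · intro z hz
    by_cases hzp : z = p
    · subst hzp; rwa [hhp]
    · have hle : (hang z).length ≤ 1 := by
        rw [hhz z hzp, Finset.length_toList, Finset.card_le_one]
        intro a ha b hb
        simp at ha hb
        exact hf ha.1 hb.1 (ha.2.trans hb.2.symm)
      match hl : hang z with
      | [] => simp
      | [b] =>
        have hb : b ∈ hang z := by simp [hl]
        rw [hhz z hzp] at hb
        simp at hb
        have := (hfD b hb.1).2.2
        rw [hb.2] at this
        simpa using this
      | _ :: _ :: _ => simp [hl] at hle
  · rw [List.nodup_flatMap]
    refine ⟨fun z hz => List.nodup_cons.2 ⟨fun hz' => hsub z z hz' hz, ?_⟩, ?_⟩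
    · by_cases hzp : z = p
      · subst hzp; rwa [hhp]
      · rw [hhz z hzp]; exact Finset.nodup_toList _
    · refine List.Pairwise.imp_of_mem ?_ hD
      intro z z' hz hz' hne
      simp only [Function.onFun]
      intro w hw hw'
      rw [List.mem_cons] at hw hw'
      rcases hw with rfl | hw <;> rcases hw' with rfl | hw'
      · exact hne rfl
      · exact hsub _ _ hw' hz
      · exact hsub _ _ hw hz'
      · exact hne (hsep z z' w hw hw')
  · intro w
    rcases hV w with hw | hw | hw
    · exact ⟨w, hw, by simp⟩
    · exact ⟨p, hp, by simp [hhp, hw]⟩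
    · obtain ⟨h1, h2, h3⟩ := hfD w hw
      exact ⟨f w, h1, by simp [hhz _ h2, hw]⟩

section Tough

variable [Fintype V] {G : SimpleGraph V} {β : ℝ}

/-- Lower bound for the number of components by vertices all of whose neighbours are removed. -/
theorem IsTough.card_lt (h : IsTough β G) (hβ : 1 < β) {A X : Finset V} (hAX : Disjoint A X)
    (hA : ∀ a ∈ A, ∀ b ∈ A, a ≠ b → (∀ u, G.Adj a u → u ∈ X) ∨ (∀ u, G.Adj b u → u ∈ X))
    (h2 : 2 ≤ A.card) : A.card < X.card := by
  classical
  have hiso : ∀ a b : ((X : Set V)ᶜ : Set V), (∀ u, G.Adj a u → u ∈ X) →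
      (G.induce ((X : Set V)ᶜ)).Reachable a b → a = b := by
    rintro a b ha ⟨w⟩
    cases w with
    | nil => rfl
    | @cons _ v _ hadj _ => exact absurd (Finset.mem_coe.2 (ha _ hadj)) v.2
  have hle : A.card ≤ Nat.card (G.induce ((X : Set V)ᶜ)).ConnectedComponent := by
    have hmem : ∀ a : A, (a : V) ∈ ((X : Set V)ᶜ : Set V) := fun a => by
      simpa using Finset.disjoint_left.1 hAX a.2
    have : Function.Injective (fun a : A =>
        (G.induce ((X : Set V)ᶜ)).connectedComponentMk ⟨a, hmem a⟩) := by
      intro a b hab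
      by_contra hne
      have hne' : (a : V) ≠ b := fun h => hne (Subtype.ext h)
      have hr := ConnectedComponent.exact hab
      rcases hA a a.2 b b.2 hne' with hh | hh
      · exact hne' (Subtype.mk.inj (hiso ⟨a, hmem a⟩ ⟨b, hmem b⟩ hh hr))
      · exact hne' (Subtype.mk.inj (hiso ⟨b, hmem b⟩ ⟨a, hmem a⟩ hh hr.symm)).symm
    have := Nat.card_le_card_of_injective _ this
    simpa using this
  have := h X (h2.trans hle)
  have h1 : (A.card : ℝ) ≤ Nat.card (G.induce ((X : Set V)ᶜ)).ConnectedComponent := by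
    exact_mod_cast hle
  have h3 : (2 : ℝ) ≤ A.card := by exact_mod_cast h2
  have : (A.card : ℝ) < X.card := by nlinarith
  exact_mod_cast this

variable [DecidableEq V]

theorem IsTough.card_add_one_lt (h : IsTough β G) (hβ : 1 < β) {S X : Finset V} {w : V}
    (hS : S.Nonempty) (hSX : ∀ s ∈ S, ∀ u, G.Adj s u → u ∈ X) (hd : Disjoint S X)
    (hwS : w ∉ S) (hwX : w ∉ X) : S.card + 1 < X.card := by
  have := h.card_lt hβ (A := insert w S) (X := X) ?_ ?_ ?_
  · rwa [Finset.card_insert_of_notMem hwS] at this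
  · exact Finset.disjoint_insert_left.2 ⟨hwX, hd⟩
  · intro a ha b hb hab
    rw [Finset.mem_insert] at ha hb
    rcases ha with rfl | ha
    · rcases hb with rfl | hb
      · exact absurd rfl hab
      · exact Or.inr (hSX b hb)
    · exact Or.inl (hSX a ha)
  · rw [Finset.card_insert_of_notMem hwS]
    have := hS.card_pos
    omega

theorem IsTough.card_lt_of_independent (h : IsTough β G) (hβ : 1 < β)
    (hV : 3 ≤ Fintype.card V) {S X : Finset V}
    (hS : S.Nonempty) (hSX : ∀ s ∈ S, ∀ u, G.Adj s u → u ∈ X) (hd : Disjoint S X) :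
    S.card < X.card := by
  rcases Nat.lt_or_ge S.card 2 with h1 | h2
  · by_cases hw : ∃ w, w ∉ S ∧ w ∉ X
    · obtain ⟨w, hw, hw'⟩ := hw
      have := h.card_add_one_lt hβ hS hSX hd hw hw'
      omega
    · push Not at hw
      have : Finset.univ ⊆ S ∪ X := fun w _ => by
        by_cases hwS : w ∈ S
        · simp [hwS]
        · simp [hw w hwS]
      have h4 := (Finset.card_le_card this).trans (Finset.card_union_le _ _)
      rw [Finset.card_univ] at h4
      omega
  · exact h.card_lt hβ hd (fun a ha _ _ _ => Or.inl (hSX a ha)) h2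

/-- Hall's theorem in the form used below. -/
theorem exists_injOn_adj_notMem {G : SimpleGraph V} (J F : Finset V)
    (hJ : ∀ S ⊆ J, S.Nonempty → ∀ X : Finset V, (∀ u, u ∈ X ↔ ∃ s ∈ S, G.Adj s u) →
      S.card + F.card ≤ X.card) :
    ∃ f : V → V, Set.InjOn f J ∧ ∀ j ∈ J, G.Adj (f j) j ∧ f j ∉ F := by
  classical
  have hall : ∀ S : Finset J,
      S.card ≤ (S.biUnion fun j : J => G.neighborFinset (j : V) \ F).card := by
    intro S
    rcases S.eq_empty_or_nonempty with rfl | hS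
    · simp
    let X := (S.map (Function.Embedding.subtype _)).biUnion fun j => G.neighborFinset j
    have := hJ (S.map (Function.Embedding.subtype _))
      (fun x hx => by simp at hx; exact hx.1) (by simpa using hS) X (by
        intro u; simp only [X, Finset.mem_biUnion, mem_neighborFinset])
    rw [Finset.card_map] at this
    have h2 : X \ F ⊆ S.biUnion fun j : J => G.neighborFinset (j : V) \ F := by
      intro u hu
      simp only [X, Finset.mem_sdiff, Finset.mem_biUnion, Finset.mem_map] at hu
      obtain ⟨⟨_, ⟨j, hj, rfl⟩, hju⟩, hu⟩ := hu
      exact Finset.mem_biUnion.2 ⟨j, hj, Finset.mem_sdiff.2 ⟨hju, hu⟩⟩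
    have h3 := Finset.card_le_card h2
    have h4 := Finset.le_card_sdiff F X
    omega
  obtain ⟨f, hf, hf'⟩ := (Finset.all_card_le_biUnion_card_iff_exists_injective
    (fun j : J => G.neighborFinset (j : V) \ F)).1 hall
  refine ⟨fun v => if hv : v ∈ J then f ⟨v, hv⟩ else v, ?_, ?_⟩
  · intro a ha b hb hab
    simp only [Finset.mem_coe] at ha hb
    simp only [ha, hb, dif_pos] at hab
    exact congrArg Subtype.val (hf hab)
  · intro j hj
    have := hf' ⟨j, hj⟩
    simp only [Finset.mem_sdiff, mem_neighborFinset] at this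
    simp only [hj, dif_pos]
    exact ⟨this.1.symm, this.2⟩

end Tough

/-- An edge-dominating cycle with three consecutive vertices forming a triangle makes a graph of
toughness above one prism-Hamiltonian. -/
theorem IsTough.prismHamiltonian_of_dominating [Fintype V] [DecidableEq V] {G : SimpleGraph V}
    {β : ℝ} (h : IsTough β G) (hβ : 1 < β) {L : List V} {a v b : V} (hL : ListWalk G L b a)
    (hn : L.Nodup) (hv : v ∉ L) (hab : G.Adj a b) (hav : G.Adj a v) (hvb : G.Adj v b)
    (hdom : ∀ x y, x ∉ v :: L → y ∉ v :: L → ¬ G.Adj x y) : PrismHamiltonian G := by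
  have hV : 3 ≤ Fintype.card V := by
    have : ({a, v, b} : Finset V).card = 3 := by
      rw [Finset.card_eq_three]; exact ⟨a, v, b, hav.ne, hab.ne, hvb.ne, rfl⟩
    rw [← this]; exact Finset.card_le_univ _
  let I : Finset V := Finset.univ.filter (· ∉ v :: L)
  have hI : ∀ x, x ∈ I ↔ x ∉ v :: L := by simp [I]
  have hind : ∀ S ⊆ I, ∀ X : Finset V, (∀ u, u ∈ X ↔ ∃ s ∈ S, G.Adj s u) → ∀ x ∈ I, x ∉ X := by
    intro S hS X hX x hx hxX
    obtain ⟨s, hs, hsx⟩ := (hX x).1 hxX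
    exact hdom s x ((hI _).1 (hS hs)) ((hI _).1 hx) hsx
  have hout : ∀ j ∈ I, ∀ u, G.Adj u j → u ∈ v :: L := by
    intro j hj u hu
    by_contra hc
    exact hdom u j hc ((hI _).1 hj) hu
  have hmem : ∀ z, z ∈ L ∨ z = v ∨ z ∈ I := by
    intro z; rw [hI, List.mem_cons]; tauto
  rcases Nat.even_or_odd L.length with he | ho
  · by_cases hw : ∃ w ∈ I, G.Adj v w
    · obtain ⟨w, hwI, hvw⟩ := hw
      have hwv : w ∉ v :: L := (hI w).1 hwI
      rw [List.mem_cons, not_or] at hwv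
      obtain ⟨f, hf, hf'⟩ := exists_injOn_adj_notMem (G := G) (I.erase w) {a, v} (by
        intro S hS hne X hX
        have hSI : S ⊆ I := hS.trans (Finset.erase_subset _ _)
        have := h.card_add_one_lt hβ (S := S) (X := X) (w := w) hne
          (fun s hs u hu => (hX u).2 ⟨s, hs, hu⟩)
          (Finset.disjoint_left.2 fun s hs => hind S hSI X hX s (hSI hs))
          (fun hwS => by simpa using hS hwS) (hind S hSI X hX w hwI)
        have h2 : ({a, v} : Finset V).card ≤ 2 := Finset.card_le_two
        omega)
      refine hL.prismHamiltonian_of_matching (E := [v, w]) (p := a) (J := I.erase w) (f := f)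
        hab he hn hL.right_mem (by simp [hav, hvw]) (by simp [hvw.ne]) ?_ ?_ ?_ ?_ hf ?_
      · simp [hv, hwv.2]
      · simp [hI]
      · intro z hz
        have := (hI z).1 (Finset.mem_of_mem_erase hz)
        rw [List.mem_cons, not_or] at this
        exact this.2
      · intro z
        have := hmem z
        simp only [List.mem_cons, Finset.mem_erase]
        tauto
      · intro j hj
        obtain ⟨h1, h2⟩ := hf' j hj
        have := hout j (Finset.mem_of_mem_erase hj) _ h1
        simp only [List.mem_cons, Finset.mem_insert, Finset.mem_singleton] at this h2
        tauto
    · push Not at hw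
      obtain ⟨f, hf, hf'⟩ := exists_injOn_adj_notMem (G := G) I {a} (by
        intro S hS hne X hX
        have := h.card_lt_of_independent hβ hV (S := S) (X := X) hne
          (fun s hs u hu => (hX u).2 ⟨s, hs, hu⟩)
          (Finset.disjoint_left.2 fun s hs => hind S hS X hX s (hS hs))
        rw [Finset.card_singleton]; omega)
      refine hL.prismHamiltonian_of_matching (E := [v]) (p := a) (J := I) (f := f)
        hab he hn hL.right_mem (by simp [hav]) (by simp) ?_ ?_ ?_ ?_ hf ?_
      · simp [hv]
      · simp [hI]
      · intro z hz
        have := (hI z).1 hz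
        rw [List.mem_cons, not_or] at this
        exact this.2
      · intro z
        have := hmem z
        simp only [List.mem_cons]
        tauto
      · intro j hj
        obtain ⟨h1, h2⟩ := hf' j hj
        have := hout j hj _ h1
        have h3 : f j ≠ v := fun hh => hw j hj (hh ▸ h1)
        simp only [List.mem_cons, Finset.mem_singleton] at this h2
        tauto
  · obtain ⟨f, hf, hf'⟩ := exists_injOn_adj_notMem (G := G) I {a} (by
        intro S hS hne X hX
        have := h.card_lt_of_independent hβ hV (S := S) (X := X) hne
          (fun s hs u hu => (hX u).2 ⟨s, hs, hu⟩)
          (Finset.disjoint_left.2 fun s hs => hind S hS X hX s (hS hs))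
        rw [Finset.card_singleton]; omega)
    refine (hL.cons hvb).prismHamiltonian_of_matching (E := []) (p := a) (J := I) (f := f)
      hav (by rw [List.length_cons]; exact ho.add_one) (List.nodup_cons.2 ⟨hv, hn⟩)
      (List.mem_cons_of_mem _ hL.right_mem) (by simp) (by simp) (by simp) (by simp) ?_ ?_ hf ?_
    · intro z hz; exact (hI z).1 hz
    · intro z
      have := hmem z
      simp only [List.mem_cons]
      tauto
    · intro j hj
      obtain ⟨h1, h2⟩ := hf' j hj
      have := hout j hj _ h1
      rw [Finset.mem_singleton] at h2
      exact ⟨this, h2, h1⟩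

theorem List.exists_eq_of_not_nodup {α : Type*} {l : List α} (h : ¬ l.Nodup) :
    ∃ A z B C, l = A ++ z :: (B ++ z :: C) := by
  induction l with
  | nil => simp at h
  | cons a t ih =>
    by_cases ha : a ∈ t
    · obtain ⟨B, C, rfl⟩ := List.append_of_mem ha
      exact ⟨[], a, B, C, by simp⟩
    · obtain ⟨A, z, B, C, rfl⟩ := ih fun ht => h (List.nodup_cons.2 ⟨ha, ht⟩)
      exact ⟨a :: A, z, B, C, by simp⟩

theorem List.exists_eq_of_mem_of_mem {α : Type*} {l : List α} {x y : α} (hx : x ∈ l) (hy : y ∈ l)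
    (hne : x ≠ y) :
    ∃ A B C, l = A ++ x :: (B ++ y :: C) ∨ l = A ++ y :: (B ++ x :: C) := by
  obtain ⟨A, C, rfl⟩ := List.append_of_mem hx
  rw [List.mem_append, List.mem_cons] at hy
  rcases hy with hy | hy | hy
  · obtain ⟨A', B, rfl⟩ := List.append_of_mem hy
    exact ⟨A', B, C, Or.inr (by simp)⟩
  · exact absurd hy.symm hne
  · obtain ⟨B, C', rfl⟩ := List.append_of_mem hy
    exact ⟨A, B, C', Or.inl rfl⟩

theorem ListWalk.split_at {G : SimpleGraph V} {A C : List V} {x y z : V} :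
    ListWalk G (A ++ z :: C) x y ↔ ListWalk G (A ++ [z]) x z ∧ ListWalk G (z :: C) z y := by
  simp only [ListWalk]
  rw [List.isChain_split]
  have h1 : (A ++ z :: C).head? = (A ++ [z]).head? := by cases A <;> simp
  have h2 : (A ++ z :: C).getLast? = (z :: C).getLast? :=
    List.getLast?_append_of_ne_nil _ (by simp)
  rw [h1, h2]
  simp
  tauto

/-- In a 5-chordal graph every closed walk of odd length contains a triangle. -/
theorem FiveChordal.exists_triangle {G : SimpleGraph V} (hG : FiveChordal G) {m : List V} {x : V}
    (hm : ListWalk G m x x) (he : Even m.length) :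
    ∃ p ∈ m, ∃ q ∈ m, ∃ r ∈ m, G.Adj p q ∧ G.Adj q r ∧ G.Adj p r := by
  classical
  induction hn : m.length using Nat.strong_induction_on generalizing m x with
  | _ n ih =>
  subst hn
  have key : ∀ (m' : List V) (x' : V), ListWalk G m' x' x' → Even m'.length →
      m'.length < m.length → m' ⊆ m →
      ∃ p ∈ m, ∃ q ∈ m, ∃ r ∈ m, G.Adj p q ∧ G.Adj q r ∧ G.Adj p r := by
    intro m' x' h1 h2 h3 h4
    obtain ⟨p, hp, q, hq, r, hr, h⟩ := ih _ h3 h1 h2 rfl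
    exact ⟨p, h4 hp, q, h4 hq, r, h4 hr, h⟩
  obtain ⟨t, rfl⟩ := hm.eq_cons
  by_cases ht : t.Nodup
  · match t with
    | [] => simp at he
    | [p] =>
      obtain rfl : p = x := by have := hm.2.2; simpa using this
      have := hm.1
      simp at this
    | [p, q] => simp [Nat.even_iff] at he
    | [p, q, r] =>
      obtain rfl : r = x := by have := hm.2.2; simpa using this
      have := hm.1
      simp only [List.isChain_cons_cons] at this
      exact ⟨p, by simp, q, by simp, r, by simp, this.2.1, this.2.2.1, this.1.symm⟩
    | [_, _, _, _] => simp [Nat.even_iff] at he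
    | y :: b :: c :: d :: e :: t =>
      obtain ⟨h1, h2⟩ := hm.tail
      obtain ⟨w, hw1, hw2⟩ := h1.exists_isCycle h2 ht (by simp)
      set t' := y :: b :: c :: d :: e :: t with ht'
      have hlen : 5 ≤ w.length := by
        have := w.length_support
        rw [hw2, List.length_cons] at this
        have h5 : 5 ≤ t'.length := by simp [ht']
        omega
      obtain ⟨p, q, hp, hq, hpq, hedge⟩ := hG x w hw1 hlen
      rw [hw2] at hp hq
      have hxt : x ∈ t' := h1.right_mem
      replace hp : p ∈ t' := by rcases List.mem_cons.1 hp with rfl | hp <;> assumption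
      replace hq : q ∈ t' := by rcases List.mem_cons.1 hq with rfl | hq <;> assumption
      have hinf : ∀ u v, s(u, v) = s(p, q) → ¬ [u, v] <:+: x :: t' := by
        intro u v huv hi
        apply hedge
        rw [← huv, ← Walk.infix_support_iff_mem_edges, hw2]
        exact Or.inl hi
      have main : ∀ u v A B C, s(u, v) = s(p, q) → G.Adj u v → t' = A ++ u :: (B ++ v :: C) →
          ∃ p ∈ x :: t', ∃ q ∈ x :: t', ∃ r ∈ x :: t', G.Adj p q ∧ G.Adj q r ∧ G.Adj p r := by
        intro u v A B C huv hadj htt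
        have hB : B ≠ [] := by
          rintro rfl
          exact hinf u v huv ⟨x :: A, C, by rw [htt]; simp⟩
        have hAC : A ≠ [] ∨ C ≠ [] := by
          by_contra hcon
          push Not at hcon
          obtain ⟨rfl, rfl⟩ := hcon
          have hvx : v = x := by
            have := h1.2.2
            rw [htt, List.nil_append, ← List.cons_append,
              List.getLast?_append_of_ne_nil _ (by simp)]
              at this
            simpa using this
          exact hinf v u (Sym2.eq_swap.trans huv) ⟨[], B ++ [v], by rw [htt, hvx]; simp⟩
        rw [htt, ← List.cons_append, ListWalk.split_at] at hm
        obtain ⟨ha, hb⟩ := hm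
        rw [← List.cons_append, ListWalk.split_at] at hb
        obtain ⟨hb, hc⟩ := hb
        have e : (x :: t').length = A.length + B.length + C.length + 3 := by
          rw [htt]; simp; omega
        rw [e] at he
        have hB' := List.length_pos_iff.2 hB
        have hAC' : 0 < A.length ∨ 0 < C.length :=
          hAC.imp List.length_pos_iff.2 List.length_pos_iff.2
        rcases Nat.even_or_odd (B.length + 3) with h3 | h3
        · refine key _ _ (hb.concat hadj.symm) (by simpa using h3) ?_ ?_
          · rw [e]; simp; omega
          · rw [htt]; intro z; simp; tauto
        · refine key _ _ (ha.append hc hadj) ?_ ?_ ?_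
          · have : (x :: A ++ [u] ++ v :: C).length = A.length + C.length + 3 := by simp; omega
            rw [this]
            rw [Nat.even_iff] at he ⊢
            rw [Nat.odd_iff] at h3
            omega
          · rw [e]; simp; omega
          · rw [htt]; intro z; simp; tauto
      obtain ⟨A, B, C, h | h⟩ := List.exists_eq_of_mem_of_mem hp hq hpq.ne
      · exact main p q A B C rfl hpq h
      · exact main q p A B C Sym2.eq_swap hpq.symm h
  · obtain ⟨A, z, B, C, rfl⟩ := List.exists_eq_of_not_nodup ht
    rw [← List.cons_append, ListWalk.split_at] at hm
    obtain ⟨ha, hb⟩ := hm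
    rw [← List.cons_append, ListWalk.split_at] at hb
    obtain ⟨hb, hc⟩ := hb
    have e : (x :: (A ++ z :: (B ++ z :: C))).length = A.length + B.length + C.length + 3 := by
      simp; omega
    rw [e] at he
    rcases Nat.even_or_odd (B.length + 2) with h3 | h3
    · refine key _ _ hb (by simpa using h3) ?_ ?_
      · rw [e]; simp; omega
      · intro z; simp; tauto
    · refine key _ _ (ListWalk.split_at.2 ⟨ha, hc⟩) ?_ ?_ ?_
      · have : (x :: A ++ z :: C).length = A.length + C.length + 2 := by simp; omega
        rw [this]
        rw [Nat.even_iff] at he ⊢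
        rw [Nat.odd_iff] at h3
        omega
      · rw [e]; simp; omega
      · intro z; simp; tauto

/-- A graph of toughness above one with at least three vertices has a closed walk of odd length. -/
theorem IsTough.exists_odd_closed [Fintype V] [DecidableEq V] {G : SimpleGraph V} {β : ℝ}
    (h : IsTough β G) (hβ : 1 < β) (hV : 3 ≤ Fintype.card V) :
    ∃ m x, ListWalk G m x x ∧ Even m.length := by
  by_contra hcon
  push Not at hcon
  have h2 : G.Colorable 2 := by
    rw [two_colorable_iff_forall_loop_even]
    intro u w
    have := hcon _ u (ListWalk.of_walk w)
    rw [Walk.length_support, Nat.even_add_one, not_not] at this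
    exact this
  obtain ⟨c⟩ := h2
  have key : ∀ i j : Fin 2, i ≠ j → (Finset.univ.filter (c · = i)).Nonempty →
      (Finset.univ.filter (c · = i)).card < (Finset.univ.filter (c · = j)).card := by
    intro i j hij hne
    refine h.card_lt_of_independent hβ hV hne ?_ ?_
    · intro s hs u hsu
      have := c.valid hsu
      simp at hs ⊢
      omega
    · rw [Finset.disjoint_left]
      intro a ha hb
      simp at ha hb
      exact hij (ha.symm.trans hb)
  have : Nonempty V := Fintype.card_pos_iff.1 (by omega)
  obtain ⟨v⟩ := this
  have h1 : (Finset.univ.filter (c · = c v)).Nonempty := ⟨v, by simp⟩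
  have h3 := key (c v) (1 - c v) (by omega) h1
  have h4 := key (1 - c v) (c v) (by omega) (Finset.card_pos.1 (by omega))
  omega

/-- `A` is a union of components of `G` minus `T`. -/
def ClosedOff (G : SimpleGraph V) (T A : Finset V) : Prop :=
  Disjoint A T ∧ ∀ u ∈ A, ∀ w, G.Adj u w → w ∈ A ∨ w ∈ T

/-- `G` minus `T` has at most one component. -/
def NonSeparating (G : SimpleGraph V) (T : Finset V) : Prop :=
  ∀ A, ClosedOff G T A → A.Nonempty → ∀ u, u ∈ A ∨ u ∈ T

theorem KConnected.nonSeparating [Fintype V] {G : SimpleGraph V} {k : ℕ} (h : KConnected k G)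
    {S : Finset V} (hS : S.card < k) : NonSeparating G S := by
  rintro A ⟨hd, hA⟩ ⟨a, ha⟩ u
  by_contra hu
  push Not at hu
  have haS : a ∈ ((S : Set V)ᶜ : Set V) := by simpa using Finset.disjoint_left.1 hd ha
  have huS : u ∈ ((S : Set V)ᶜ : Set V) := by simpa using hu.2
  obtain ⟨w⟩ := (h.2 S hS).preconnected ⟨a, haS⟩ ⟨u, huS⟩
  have : ∀ (x y : ((S : Set V)ᶜ : Set V)) (_ : (G.induce ((S : Set V)ᶜ)).Walk x y),
      (x : V) ∈ A → (y : V) ∈ A := by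
    intro x y w
    induction w with
    | nil => exact id
    | @cons x y z hxy _ ih =>
      intro hx
      exact ih ((hA x hx y hxy).resolve_right y.2)
  exact hu.1 (this _ _ w ha)

/-- The vertices reachable from `l` inside `L`. -/
theorem exists_reachable_closed (G : SimpleGraph V) (L : Finset V) {l : V} (hl : l ∈ L) :
    ∃ A ⊆ L, l ∈ A ∧ (∀ u ∈ A, ∀ w ∈ L, G.Adj u w → w ∈ A) ∧
      ∀ u ∈ A, ∃ m, ListWalk G m l u ∧ m.Nodup ∧ ∀ z ∈ m, z ∈ A := by
  classical
  let A := L.filter fun u => ∃ m, ListWalk G m l u ∧ ∀ z ∈ m, z ∈ L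
  have hA : ∀ u, u ∈ A ↔ u ∈ L ∧ ∃ m, ListWalk G m l u ∧ ∀ z ∈ m, z ∈ L := by simp [A]
  have hstep : ∀ u ∈ A, ∀ w ∈ L, G.Adj u w → w ∈ A := by
    intro u hu w hw huw
    obtain ⟨_, m, hm, hmL⟩ := (hA u).1 hu
    refine (hA w).2 ⟨hw, m ++ [w], hm.concat huw, ?_⟩
    intro z hz
    rcases List.mem_append.1 hz with hz | hz
    · exact hmL z hz
    · rw [List.mem_singleton] at hz; rwa [hz]
  have hlA : l ∈ A := (hA l).2 ⟨hl, [l], ListWalk.singleton l, by simpa using hl⟩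
  refine ⟨A, Finset.filter_subset _ _, hlA, hstep, ?_⟩
  intro u hu
  obtain ⟨_, m, hm, hmL⟩ := (hA u).1 hu
  obtain ⟨p, rfl⟩ := hm.exists_walk
  refine ⟨p.bypass.support, ListWalk.of_walk _, p.bypass_isPath.support_nodup, ?_⟩
  intro z hz
  have hz := p.support_bypass_subset_support hz
  have h1 := ListWalk.of_walk (p.takeUntil z hz)
  refine (hA z).2 ⟨hmL z hz, _, h1, fun y hy => hmL y (p.support_takeUntil_subset_support hz hy)⟩

section

variable [DecidableEq V]

/-- A vertex of a minimal cut has neighbours on every side. -/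
theorem ClosedOff.exists_adj {G : SimpleGraph V} {T L : Finset V} (h : ClosedOff G T L)
    (hne : L.Nonempty) {t : V} (ht : t ∈ T) (hT : NonSeparating G (T.erase t)) :
    ∃ l ∈ L, G.Adj t l := by
  by_contra hcon
  push Not at hcon
  have htL : t ∉ L := fun h' => Finset.disjoint_left.1 h.1 h' ht
  have := hT L ⟨Finset.disjoint_left.2 fun u hu hu' =>
    Finset.disjoint_left.1 h.1 hu (Finset.mem_of_mem_erase hu'), ?_⟩ hne t
  · simp [htL] at this
  · intro u hu w huw
    rcases h.2 u hu w huw with h' | h'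
    · exact Or.inl h'
    · refine Or.inr (Finset.mem_erase.2 ⟨?_, h'⟩)
      rintro rfl
      exact hcon u hu huw.symm

theorem ClosedOff.compl [Fintype V] {G : SimpleGraph V} {T L : Finset V} (h : ClosedOff G T L) :
    ClosedOff G T (Finset.univ \ (L ∪ T)) := by
  refine ⟨Finset.disjoint_left.2 fun u hu hu' => ?_, fun u hu w huw => ?_⟩
  · simp at hu; exact hu.2 hu'
  · by_contra hcon
    simp only [Finset.mem_sdiff, Finset.mem_univ, true_and, Finset.mem_union] at hu hcon
    push Not at hcon hu
    rcases hcon.1 with h1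
    have hwL : w ∈ L := by tauto
    have := h.2 w hwL u huw.symm
    tauto

/-- Three vertices with neighbours in a connected set `L` give a triangle meeting `L`. -/
theorem FiveChordal.exists_triangle_of_side {G : SimpleGraph V} (hG : FiveChordal G)
    {a v b : V} {L : Finset V} (hav : G.Adj a v) (hvb : G.Adj v b) (hab : G.Adj a b)
    (hL : ∀ t ∈ ({a, v, b} : Finset V), ∃ l ∈ L, G.Adj t l)
    (hc : ∀ x ∈ L, ∀ y ∈ L, ∃ m, ListWalk G m x y ∧ ∀ z ∈ m, z ∈ L) :
    ∃ p q r, G.Adj p q ∧ G.Adj q r ∧ G.Adj p r ∧ p ∈ L ∧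
      ∀ z ∈ ({p, q, r} : Finset V), z ∈ L ∨ z ∈ ({a, v, b} : Finset V) := by
  obtain ⟨la, hla, hala⟩ := hL a (by simp)
  obtain ⟨lb, hlb, hblb⟩ := hL b (by simp)
  obtain ⟨lv, hlv, hvlv⟩ := hL v (by simp)
  have key : ∀ c d lc ld m, G.Adj c d → G.Adj c lc → G.Adj d ld → ListWalk G m lc ld →
      (∀ z ∈ m, z ∈ L) → Even (m.length + 3) → c ∈ ({a, v, b} : Finset V) →
      d ∈ ({a, v, b} : Finset V) →
      ∃ p q r, G.Adj p q ∧ G.Adj q r ∧ G.Adj p r ∧ p ∈ L ∧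
        ∀ z ∈ ({p, q, r} : Finset V), z ∈ L ∨ z ∈ ({a, v, b} : Finset V) := by
    intro c d lc ld m hcd hc hd hm hmL he hcT hdT
    have hw : ListWalk G (c :: (m ++ [d] ++ [c])) c c :=
      ((hm.concat hd.symm).concat hcd.symm).cons hc
    obtain ⟨p, hp, q, hq, r, hr, h1, h2, h3⟩ := hG.exists_triangle hw (by
      simpa [Nat.even_iff, add_assoc] using he)
    have hmem : ∀ z ∈ c :: (m ++ [d] ++ [c]), z ∈ L ∨ z = c ∨ z = d := by
      intro z hz
      simp only [List.mem_cons, List.mem_append, List.not_mem_nil, or_false] at hz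
      have := hmL z
      tauto
    have hall : ∀ z ∈ c :: (m ++ [d] ++ [c]), z ∈ L ∨ z ∈ ({a, v, b} : Finset V) := by
      intro z hz
      rcases hmem z hz with h | rfl | rfl
      exacts [Or.inl h, Or.inr hcT, Or.inr hdT]
    have htri : ∀ p q r, p ∈ c :: (m ++ [d] ++ [c]) → q ∈ c :: (m ++ [d] ++ [c]) →
        r ∈ c :: (m ++ [d] ++ [c]) →
        ∀ z ∈ ({p, q, r} : Finset V), z ∈ L ∨ z ∈ ({a, v, b} : Finset V) := by
      intro p q r hp hq hr z hz
      rw [Finset.mem_insert, Finset.mem_insert, Finset.mem_singleton] at hz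
      rcases hz with rfl | rfl | rfl
      exacts [hall _ hp, hall _ hq, hall _ hr]
    have hsome : p ∈ L ∨ q ∈ L ∨ r ∈ L := by
      by_contra hcon
      push Not at hcon
      have e1 := (hmem p hp).resolve_left hcon.1
      have e2 := (hmem q hq).resolve_left hcon.2.1
      have e3 := (hmem r hr).resolve_left hcon.2.2
      rcases e1 with e1 | e1 <;> rcases e2 with e2 | e2 <;> rcases e3 with e3 | e3 <;>
        first
        | exact h1.ne (e1.trans e2.symm)
        | exact h2.ne (e2.trans e3.symm)
        | exact h3.ne (e1.trans e3.symm)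
    rcases hsome with h | h | h
    · exact ⟨p, q, r, h1, h2, h3, h, htri p q r hp hq hr⟩
    · exact ⟨q, p, r, h1.symm, h3, h2, h, htri q p r hq hp hr⟩
    · exact ⟨r, p, q, h3.symm, h1, h2.symm, h, htri r p q hr hp hq⟩
  obtain ⟨m1, hm1, hm1L⟩ := hc la hla lb hlb
  obtain ⟨m2, hm2, hm2L⟩ := hc lb hlb lv hlv
  rcases Nat.even_or_odd (m1.length + 3) with h | h1
  · exact key a b la lb m1 hab hala hblb hm1 hm1L h (by simp) (by simp)
  rcases Nat.even_or_odd (m2.length + 3) with h | h2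
  · exact key b v lb lv m2 hvb.symm hblb hvlv hm2 hm2L h (by simp) (by simp)
  obtain ⟨A, rfl⟩ := hm1.eq_concat
  obtain ⟨C, rfl⟩ := hm2.eq_cons
  refine key a v la lv (A ++ lb :: C) hav hala hvlv (ListWalk.split_at.2 ⟨hm1, hm2⟩) ?_ ?_
    (by simp) (by simp)
  · intro z hz
    rcases List.mem_append.1 hz with hz | hz
    · exact hm1L z (by simp [hz])
    · exact hm2L z hz
  · simp only [List.length_append, List.length_cons, List.length_nil, Nat.odd_iff,
      Nat.even_iff] at *
    omega

theorem FiveChordal.exists_nonSeparating_triangle [Fintype V] {G : SimpleGraph V}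
    (hG : FiveChordal G) (hconn : ∀ S : Finset V, S.card < 3 → NonSeparating G S)
    {a v b : V} (hav : G.Adj a v) (hvb : G.Adj v b) (hab : G.Adj a b) :
    ∃ a v b, G.Adj a v ∧ G.Adj v b ∧ G.Adj a b ∧ NonSeparating G {a, v, b} := by
  by_contra hno
  push Not at hno
  have hcard : ∀ {a v b : V}, G.Adj a v → G.Adj v b → G.Adj a b →
      ({a, v, b} : Finset V).card = 3 := fun h1 h2 h3 =>
    Finset.card_eq_three.2 ⟨_, _, _, h1.ne, h3.ne, h2.ne, rfl⟩
  have key : ∀ n, ∀ a v b L, G.Adj a v → G.Adj v b → G.Adj a b → ClosedOff G {a, v, b} L →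
      L.Nonempty → (∃ u, u ∉ L ∧ u ∉ ({a, v, b} : Finset V)) → L.card = n → False := by
    intro n
    induction n using Nat.strong_induction_on with
    | _ n ih =>
    rintro a v b L hav hvb hab hL hLne ⟨u0, hu0, hu0'⟩ rfl
    have herase : ∀ t ∈ ({a, v, b} : Finset V),
        NonSeparating G (({a, v, b} : Finset V).erase t) := by
      intro t ht
      apply hconn
      rw [Finset.card_erase_of_mem ht, hcard hav hvb hab]
      omega
    have hM := hL.compl
    set T : Finset V := {a, v, b} with hT
    set M := Finset.univ \ (L ∪ T) with hMdef
    have hMmem : ∀ z, z ∈ M ↔ z ∉ L ∧ z ∉ T := by intro z; simp [hMdef]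
    have hMne : M.Nonempty := ⟨u0, (hMmem u0).2 ⟨hu0, hu0'⟩⟩
    obtain ⟨p, q, r, hpq, hqr, hpr, hpL, hsub⟩ := hG.exists_triangle_of_side hav hvb hab
      (fun t ht => hL.exists_adj hLne ht (herase t ht)) (by
        intro x hx y hy
        obtain ⟨A, hAL, hxA, hA, hA'⟩ := exists_reachable_closed G L hx
        have hyA : y ∈ A := by
          by_contra hyA
          refine ih A.card (Finset.card_lt_card ⟨hAL, fun h => hyA (h hy)⟩) a v b A hav hvb hab
            ⟨Finset.disjoint_of_subset_left hAL hL.1, ?_⟩ ⟨x, hxA⟩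
            ⟨u0, fun h => hu0 (hAL h), hu0'⟩ rfl
          intro u hu w huw
          exact (hL.2 u (hAL hu) w huw).imp_left fun hw => hA u hu w hw huw
        obtain ⟨m, hm, _, hmA⟩ := hA' y hyA
        exact ⟨m, hm, fun z hz => hAL (hmA z hz)⟩)
    have hcT' := hcard hpq hqr hpr
    have hnsep := hno p q r hpq hqr hpr
    have hpT' : p ∈ ({p, q, r} : Finset V) := by simp
    set T' : Finset V := {p, q, r} with hT'
    obtain ⟨t, htT, htT'⟩ : ∃ t ∈ T, t ∉ T' := by
      by_contra hcon
      push Not at hcon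
      have heq : T = T' := Finset.eq_of_subset_of_card_le hcon (by rw [hcT', hcard hav hvb hab])
      exact Finset.disjoint_left.1 hL.1 hpL (heq ▸ hpT')
    have hside : ∃ A, ClosedOff G T' A ∧ A.Nonempty ∧ t ∉ A := by
      rw [NonSeparating] at hnsep
      push Not at hnsep
      obtain ⟨A, hA, hAne, u, hu, hu'⟩ := hnsep
      by_cases htA : t ∈ A
      · exact ⟨_, hA.compl, ⟨u, by simp [hu, hu']⟩, by simp [htA]⟩
      · exact ⟨A, hA, hAne, htA⟩
    obtain ⟨A, hA, hAne, htA⟩ := hside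
    have hAM : ∀ u ∈ A, u ∉ M := by
      by_contra hcon
      push Not at hcon
      obtain ⟨u, huA, huM⟩ := hcon
      have := herase t htT (A ∩ M) ⟨Finset.disjoint_left.2 fun z hz hz' =>
        ((hMmem z).1 (Finset.mem_inter.1 hz).2).2 (Finset.mem_of_mem_erase hz'), ?_⟩
        ⟨u, Finset.mem_inter.2 ⟨huA, huM⟩⟩ t
      · simp [htA] at this
      · intro x hx w hxw
        obtain ⟨hxA, hxM⟩ := Finset.mem_inter.1 hx
        have hw := hA.2 x hxA w hxw
        rcases hM.2 x hxM w hxw with hwM | hwT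
        · refine Or.inl (Finset.mem_inter.2 ⟨hw.resolve_right fun hwT' => ?_, hwM⟩)
          rcases hsub w hwT' with h' | h'
          · exact ((hMmem w).1 hwM).1 h'
          · exact ((hMmem w).1 hwM).2 h'
        · refine Or.inr (Finset.mem_erase.2 ⟨?_, hwT⟩)
          rintro rfl
          exact hw.elim htA htT'
    have hALsub : A ⊆ L := by
      intro u hu
      by_contra huL
      have huT : u ∈ T := by
        by_contra huT
        exact hAM u hu ((hMmem u).2 ⟨huL, huT⟩)
      obtain ⟨m, hm, hum⟩ := hM.exists_adj hMne huT (herase u huT)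
      rcases hA.2 u hu m hum with h' | h'
      · exact hAM m h' hm
      · rcases hsub m h' with h' | h'
        · exact ((hMmem m).1 hm).1 h'
        · exact ((hMmem m).1 hm).2 h'
    have hpA : p ∉ A := fun h => Finset.disjoint_left.1 hA.1 h hpT'
    exact ih A.card (Finset.card_lt_card ⟨hALsub, fun h => hpA (h hpL)⟩) p q r A hpq hqr hpr hA hAne
      ⟨t, htA, htT'⟩ rfl
  have := hno a v b hav hvb hab
  rw [NonSeparating] at this
  push Not at this
  obtain ⟨A, hA, hAne, hu⟩ := this
  exact key _ a v b A hav hvb hab hA hAne hu rfl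

end

/-- A cycle `v, L` where `L` runs from `b` to `a`, and `a, v, b` form a nonseparating triangle. -/
structure TriCycle [DecidableEq V] (G : SimpleGraph V) (a v b : V) (L : List V) : Prop where
  adj_av : G.Adj a v
  adj_vb : G.Adj v b
  adj_ab : G.Adj a b
  walk : ListWalk G L b a
  nodup : L.Nodup
  notMem : v ∉ L
  nonSep : NonSeparating G {a, v, b}
  len : 3 ≤ L.length

/-- `x` has a neighbour in `K`. -/
def Attached (G : SimpleGraph V) (K : Finset V) (x : V) : Prop := ∃ u ∈ K, G.Adj x u

/-- A nontrivial component `K` off a cycle `v, L` that cannot be rerouted through `K` without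
losing a vertex with an uncovered neighbour. -/
structure TightCycle [DecidableEq V] (G : SimpleGraph V) (a v b : V) (L : List V)
    (K : Finset V) : Prop extends TriCycle G a v b L where
  off : ∀ u ∈ K, u ∉ v :: L
  closed : ∀ u ∈ K, ∀ w, G.Adj u w → w ∈ K ∨ w ∈ v :: L
  conn : ∀ x ∈ K, ∀ y ∈ K, ∃ m, ListWalk G m x y ∧ m.Nodup ∧ ∀ z ∈ m, z ∈ K
  nbr : ∀ u ∈ K, ∃ w ∈ K, G.Adj u w
  nonempty : K.Nonempty
  tight : ∀ a' v' b' L', TriCycle G a' v' b' L' → (∃ u ∈ K, u ∈ v' :: L') →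
    (∀ u ∈ v :: L, u ∉ v' :: L' → ∀ w, G.Adj u w → w ∈ v' :: L') → False

theorem List.three_le_length_of_mem {α : Type*} [DecidableEq α] {l : List α} {x y z : α}
    (hx : x ∈ l) (hy : y ∈ l) (hz : z ∈ l) (hxy : x ≠ y) (hyz : y ≠ z) (hxz : x ≠ z) :
    3 ≤ l.length := by
  have h : ({x, y, z} : Finset α).card = 3 := Finset.card_eq_three.2 ⟨x, y, z, hxy, hxz, hyz, rfl⟩
  have h2 : ({x, y, z} : Finset α) ⊆ l.toFinset := by
    intro w hw
    simp only [Finset.mem_insert, Finset.mem_singleton] at hw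
    rw [List.mem_toFinset]
    rcases hw with rfl | rfl | rfl <;> assumption
  rw [← h]
  exact (Finset.card_le_card h2).trans (List.toFinset_card_le l)

/-- Shortcutting a walk to a path. -/
theorem ListWalk.exists_nodup [DecidableEq V] {G : SimpleGraph V} {m : List V} {x y : V}
    (h : ListWalk G m x y) : ∃ m', ListWalk G m' x y ∧ m'.Nodup ∧ m' ⊆ m := by
  obtain ⟨p, rfl⟩ := h.exists_walk
  exact ⟨p.bypass.support, ListWalk.of_walk _, p.bypass_isPath.support_nodup,
    fun z hz => p.support_bypass_subset_support hz⟩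

section

variable [DecidableEq V] {G : SimpleGraph V} {a v b : V} {L : List V} {K : Finset V}

theorem TriCycle.reverse (h : TriCycle G a v b L) : TriCycle G b v a L.reverse where
  adj_av := h.adj_vb.symm
  adj_vb := h.adj_av.symm
  adj_ab := h.adj_ab.symm
  walk := h.walk.reverse
  nodup := List.nodup_reverse.2 h.nodup
  notMem := by simpa using h.notMem
  nonSep := by
    have : ({b, v, a} : Finset V) = {a, v, b} := by ext; simp; tauto
    rw [this]; exact h.nonSep
  len := by simpa using h.len

theorem TightCycle.reverse (h : TightCycle G a v b L K) : TightCycle G b v a L.reverse K where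
  toTriCycle := h.toTriCycle.reverse
  off := by simpa using h.off
  closed := by simpa using h.closed
  conn := h.conn
  nbr := h.nbr
  nonempty := h.nonempty
  tight := by simpa using h.tight

variable [Fintype V]

theorem exists_triCycle (hconn : ∀ S : Finset V, S.card < 3 → NonSeparating G S)
    (hV : 3 < Fintype.card V) (hav : G.Adj a v) (hvb : G.Adj v b) (hab : G.Adj a b)
    (hT : NonSeparating G {a, v, b}) : ∃ L, TriCycle G a v b L := by
  have hcov : ∃ u, u ∉ ({a, v, b} : Finset V) := by
    by_contra hcon
    push Not at hcon
    have h1 : (Finset.univ : Finset V) ⊆ {a, v, b} := fun u _ => hcon u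
    have h2 := Finset.card_le_card h1
    have h3 : ({a, v, b} : Finset V).card ≤ 3 := Finset.card_le_three
    rw [Finset.card_univ] at h2
    omega
  have hnb : ∀ c d e : V, c ≠ d → c ≠ e → ({c, d, e} : Finset V) = {a, v, b} →
      ∃ r, G.Adj c r ∧ r ∉ ({a, v, b} : Finset V) := by
    intro c d e hcd hce heq
    by_contra hcon
    push Not at hcon
    obtain ⟨u, hu⟩ := hcov
    have h2 : ({d, e} : Finset V).card < 3 := lt_of_le_of_lt Finset.card_le_two (by omega)
    have := hconn _ h2 {c} ⟨by simp [hcd, hce], ?_⟩ ⟨c, by simp⟩ u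
    · rw [← heq] at hu
      simp at hu this
      tauto
    · intro x hx w hxw
      rw [Finset.mem_singleton] at hx
      subst hx
      have := hcon w hxw
      rw [← heq] at this
      simp at this ⊢
      tauto
  obtain ⟨r, har, hr⟩ := hnb a v b hav.ne hab.ne rfl
  obtain ⟨q, hbq, hq⟩ := hnb b v a hvb.ne.symm hab.ne.symm (by ext; simp; tauto)
  obtain ⟨A, hAs, hqA, hA, hA'⟩ := exists_reachable_closed G (Finset.univ \ {a, v, b}) (l := q)
    (by simpa using hq)
  have hAT : ∀ u ∈ A, u ∉ ({a, v, b} : Finset V) := fun u hu => (Finset.mem_sdiff.1 (hAs hu)).2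
  have hrA : r ∈ A := by
    refine (hT A ⟨Finset.disjoint_left.2 hAT, ?_⟩ ⟨q, hqA⟩ r).resolve_right hr
    intro u hu w huw
    by_cases hw : w ∈ ({a, v, b} : Finset V)
    · exact Or.inr hw
    · exact Or.inl (hA u hu w (Finset.mem_sdiff.2 ⟨Finset.mem_univ _, hw⟩) huw)
  obtain ⟨m, hm, hmn, hmA⟩ := hA' r hrA
  have hmT : ∀ u ∈ m, u ≠ a ∧ u ≠ v ∧ u ≠ b := by
    intro u hu
    have := hAT u (hmA u hu)
    simpa using this
  refine ⟨b :: (m ++ [a]), hav, hvb, hab, (hm.concat har.symm).cons hbq, ?_, ?_, hT, ?_⟩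
  · rw [List.nodup_cons, List.nodup_append]
    refine ⟨?_, hmn, by simp, ?_⟩
    · simp only [List.mem_append, List.mem_singleton, not_or]
      exact ⟨fun h => (hmT b h).2.2 rfl, hab.ne.symm⟩
    · intro x hx y hy
      rw [List.mem_singleton] at hy
      rw [hy]
      exact (hmT x hx).1
  · simp only [List.mem_cons, List.mem_append, List.not_mem_nil, or_false, not_or]
    exact ⟨hvb.ne, fun h => (hmT v h).2.1 rfl, hav.ne.symm⟩
  · have := List.length_pos_iff.2 hm.ne_nil
    simp; omega

/-- Either some cycle through a triangle is edge-dominating or a tight cycle exists. -/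
theorem TriCycle.exists_dominating_or_tight (h : ∃ a v b L, TriCycle G a v b L) :
    ∃ a v b L, TriCycle G a v b L ∧
      ((∀ x y, x ∉ v :: L → y ∉ v :: L → ¬ G.Adj x y) ∨ ∃ K, TightCycle G a v b L K) := by
  classical
  let Ob := {o : V × V × V × List V // TriCycle G o.1 o.2.1 o.2.2.1 o.2.2.2}
  let f : Ob → ℕ := fun o => (Finset.univ.filter fun e : V × V =>
    e.1 ∉ o.1.2.1 :: o.1.2.2.2 ∧ e.2 ∉ o.1.2.1 :: o.1.2.2.2 ∧ G.Adj e.1 e.2).card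
  obtain ⟨a0, v0, b0, L0, h0⟩ := h
  obtain ⟨⟨⟨a, v, b, L⟩, ho⟩, -, hmin⟩ :=
    (measure f).wf.has_min Set.univ ⟨⟨(a0, v0, b0, L0), h0⟩, trivial⟩
  simp only at ho
  refine ⟨a, v, b, L, ho, ?_⟩
  by_cases hdom : ∀ x y, x ∉ v :: L → y ∉ v :: L → ¬ G.Adj x y
  · exact Or.inl hdom
  right
  push Not at hdom
  obtain ⟨k, k', hk, hk', hkk⟩ := hdom
  obtain ⟨K, hKs, hkK, hK, hK'⟩ :=
    exists_reachable_closed G (Finset.univ.filter (· ∉ v :: L)) (l := k)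
    (by rw [Finset.mem_filter]; exact ⟨Finset.mem_univ _, hk⟩)
  have hoff : ∀ u ∈ K, u ∉ v :: L := fun u hu => (Finset.mem_filter.1 (hKs hu)).2
  have hcl : ∀ u ∈ K, ∀ w, G.Adj u w → w ∈ K ∨ w ∈ v :: L := by
    intro u hu w huw
    by_cases hw : w ∈ v :: L
    · exact Or.inr hw
    · exact Or.inl (hK u hu w (Finset.mem_filter.2 ⟨Finset.mem_univ _, hw⟩) huw)
  have hnbr : ∀ u ∈ K, ∃ w ∈ K, G.Adj u w := by
    intro u hu
    obtain ⟨m, hm, -, hmK⟩ := hK' u hu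
    obtain ⟨t, rfl⟩ := hm.eq_concat
    by_cases ht : t = []
    · subst ht
      obtain rfl : u = k := by have := hm.2.1; simpa using this
      exact ⟨k', (hcl u hu k' hkk).resolve_right hk', hkk⟩
    · obtain ⟨x, y, h1, h2, h3⟩ := hm.split ht (by simp)
      obtain rfl : u = y := by have := h2.2.1; simpa using this
      exact ⟨x, hmK x (by simp [h1.right_mem]), h3.symm⟩
  refine ⟨K, ho, hoff, hcl, ?_, hnbr, ⟨k, hkK⟩, ?_⟩
  · intro x hx y hy
    obtain ⟨m1, h1, -, h1K⟩ := hK' x hx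
    obtain ⟨m2, h2, -, h2K⟩ := hK' y hy
    obtain ⟨t, rfl⟩ := h2.eq_cons
    obtain ⟨s, hs⟩ := h1.reverse.eq_concat
    have h3 := h1.reverse
    rw [hs] at h3
    obtain ⟨m, hm, hmn, hms⟩ := (ListWalk.split_at.2 ⟨h3, h2⟩).exists_nodup
    refine ⟨m, hm, hmn, fun z hz => ?_⟩
    rcases List.mem_append.1 (hms hz) with hz | hz
    · apply h1K z
      rw [← List.mem_reverse, hs]; simp [hz]
    · exact h2K z hz
  · intro a' v' b' L' hT' ⟨u, huK, hu⟩ hcov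
    refine hmin ⟨(a', v', b', L'), hT'⟩ trivial (Finset.card_lt_card ?_)
    obtain ⟨w, hwK, huw⟩ := hnbr u huK
    refine ⟨?_, ?_⟩
    · rintro ⟨x, y⟩ hxy
      simp only [Finset.mem_filter, Finset.mem_univ, true_and] at hxy ⊢
      refine ⟨fun hx => ?_, fun hy => ?_, hxy.2.2⟩
      · exact hxy.2.1 (hcov x hx hxy.1 y hxy.2.2)
      · exact hxy.1 (hcov y hy hxy.2.1 x hxy.2.2.symm)
    · intro hss
      have : (u, w) ∈ Finset.univ.filter fun e : V × V =>
          e.1 ∉ v :: L ∧ e.2 ∉ v :: L ∧ G.Adj e.1 e.2 := by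
        simp only [Finset.mem_filter, Finset.mem_univ, true_and]
        exact ⟨hoff u huK, hoff w hwK, huw⟩
      have := hss this
      simp only [Finset.mem_filter, Finset.mem_univ, true_and] at this
      exact this.1 hu

end

section

variable [DecidableEq V] {G : SimpleGraph V} {a v b : V} {L : List V} {K : Finset V}

theorem TightCycle.not_reroute (h : TightCycle G a v b L K) {L' : List V}
    (hw : ListWalk G L' b a) (hn : L'.Nodup) (hv : v ∉ L') (hK : ∃ u ∈ K, u ∈ L')
    (hs : ∀ u ∈ L, u ∉ L' → ∀ w, G.Adj u w → w ∈ v :: L') : False := by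
  obtain ⟨u, huK, hu⟩ := hK
  have hu' : u ≠ a ∧ u ≠ b := by
    constructor <;> rintro rfl <;> apply h.off _ huK
    · simp [h.walk.right_mem]
    · simp [h.walk.left_mem]
  refine h.tight a v b L' ⟨h.adj_av, h.adj_vb, h.adj_ab, hw, hn, hv, h.nonSep, ?_⟩
    ⟨u, huK, by simp [hu]⟩ ?_
  · exact List.three_le_length_of_mem hw.left_mem hu hw.right_mem hu'.2.symm hu'.1 h.adj_ab.ne.symm
  · intro w hw hw'
    simp only [List.mem_cons, not_or] at hw hw'
    exact hs w (hw.resolve_left hw'.1) hw'.2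

theorem TightCycle.exists_path (h : TightCycle G a v b L K) {x y : V} (hx : Attached G K x)
    (hy : Attached G K y) : ∃ P p q, ListWalk G P p q ∧ G.Adj x p ∧ G.Adj q y ∧ P.Nodup ∧
      ∀ z ∈ P, z ∈ K := by
  obtain ⟨p, hp, hxp⟩ := hx
  obtain ⟨q, hq, hyq⟩ := hy
  obtain ⟨P, h1, h2, h3⟩ := h.conn p hp q hq
  exact ⟨P, p, q, h1, hxp, hyq.symm, h2, h3⟩

theorem TightCycle.not_attached_succ (h : TightCycle G a v b L K) {A B : List V} {x y : V}
    (hL : L = A ++ B) (hA : ListWalk G A b x) (hB : ListWalk G B y a) (hx : Attached G K x) :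
    ¬ Attached G K y := by
  intro hy
  obtain ⟨P, p, q, hP, hxp, hqy, hPn, hPK⟩ := h.exists_path hx hy
  have hoff : ∀ z ∈ P, z ∉ v :: L := fun z hz => h.off z (hPK z hz)
  have hn := h.nodup
  have hv := h.notMem
  subst hL
  refine h.not_reroute (L' := A ++ (P ++ B)) (hA.append (hP.append hB hqy) hxp) ?_ ?_
    ⟨p, hPK p hP.left_mem, by simp [hP.left_mem]⟩ ?_
  · simp only [List.nodup_append, List.mem_append, List.mem_cons] at hn hoff ⊢
    grind
  · simp only [List.mem_append, List.mem_cons] at hv hoff ⊢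
    grind
  · intro u hu hu'
    simp only [List.mem_append] at hu hu'
    tauto

theorem TightCycle.exists_off_of_attached (h : TightCycle G a v b L K) {A B : List V} {x y x' : V}
    (hL : L = A ++ y :: B) (hA : ListWalk G A b x) (hB : ListWalk G B x' a)
    (hx : Attached G K x) (hx' : Attached G K x') : ∃ r, r ∉ v :: L ∧ G.Adj y r := by
  by_contra! hcon
  obtain ⟨P, p, q, hP, hxp, hqy, hPn, hPK⟩ := h.exists_path hx hx'
  have hoff : ∀ z ∈ P, z ∉ v :: L := fun z hz => h.off z (hPK z hz)
  have hn := h.nodup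
  have hv := h.notMem
  subst hL
  refine h.not_reroute (L' := A ++ (P ++ B)) (hA.append (hP.append hB hqy) hxp) ?_ ?_
    ⟨p, hPK p hP.left_mem, by simp [hP.left_mem]⟩ ?_
  · simp only [List.nodup_append, List.mem_append, List.nodup_cons, List.mem_cons] at hn hoff ⊢
    grind
  · simp only [List.mem_append, List.mem_cons] at hv hoff ⊢
    grind
  · intro u hu hu' w hw
    simp only [List.mem_append, List.mem_cons] at hu hu'
    have : u = y := by tauto
    subst this
    by_contra hw'
    refine hcon w ?_ hw
    have := hw.ne
    simp only [List.mem_append, List.mem_cons] at hw' ⊢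
    grind

theorem TightCycle.not_attached_apex (h : TightCycle G a v b L K) {A : List V} {p : V}
    (hL : L = A ++ [a]) (hA : ListWalk G A b p) (hp : Attached G K p) : ¬ Attached G K v := by
  intro hv'
  obtain ⟨P, r, q, hP, hxp, hqy, hPn, hPK⟩ := h.exists_path hp hv'
  have hoff : ∀ z ∈ P, z ∉ v :: L := fun z hz => h.off z (hPK z hz)
  have hn := h.nodup
  have hv := h.notMem
  have hav := h.adj_av.ne
  have hu' : r ≠ v ∧ r ≠ b := by
    have := hoff r hP.left_mem
    have h2 := h.walk.left_mem
    constructor <;> rintro rfl <;> simp [h2] at this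
  have hw : ListWalk G (A ++ (P ++ [v])) b v := hA.append (hP.concat hqy) hxp
  have hn' : (A ++ (P ++ [v])).Nodup := by
    subst hL
    simp only [List.nodup_append, List.mem_append, List.nodup_cons, List.mem_cons] at hn hv hoff ⊢
    grind
  refine h.tight v a b _ ⟨h.adj_av.symm, h.adj_ab, h.adj_vb, hw, hn', ?_, ?_, ?_⟩
    ⟨r, hPK r hP.left_mem, by simp [hP.left_mem]⟩ ?_
  · subst hL
    simp only [List.nodup_append, List.mem_append, List.nodup_cons, List.mem_cons] at hn hv hoff ⊢
    grind
  · have : ({v, a, b} : Finset V) = {a, v, b} := by ext; simp; tauto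
    rw [this]; exact h.nonSep
  · exact List.three_le_length_of_mem hw.left_mem (by simp [hP.left_mem]) hw.right_mem
      hu'.2.symm hu'.1
      h.adj_vb.ne.symm
  · intro u hu hu'
    subst hL
    simp only [List.mem_append, List.mem_cons, not_or] at hu hu'
    tauto

/-- A path `F` from `f` to `l` inside the edge `s(y, m)` that may replace the segment `M` of the
cycle `v, L`: it only omits `y`, and only if `y` has no neighbour off the cycle. -/
structure Detour (G : SimpleGraph V) (v : V) (L : List V) (y m : V) (M : List V) (f l : V)
    (F : List V) : Prop where
  walk : ListWalk G F f l
  nodup : F.Nodup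
  sub : ∀ z ∈ F, z = y ∨ z = m
  skip : ∀ z ∈ M, z ∉ F → z = y ∧ ∀ w, G.Adj y w → w ∈ v :: L

/-- A vertex `x` of the cycle attached to `K`, splitting `L` as `A ++ (M ++ E)` where `A` ends
in `x`, together with an edge `s(y, m)` not attached to `K`, where `y` follows `x`. The segment
`M` is a path from `y` to `l` inside this edge, and can be replaced by a path from `m` to `l`. -/
structure Spur (G : SimpleGraph V) (v b : V) (L : List V) (K : Finset V) (x y m : V)
    (A M E : List V) (l : V) : Prop where
  eq : L = A ++ (M ++ E)
  walk_left : ListWalk G A b x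
  attached : Attached G K x
  adj : G.Adj y m
  walk : ListWalk G M y l
  sub : ∀ z ∈ M, z = y ∨ z = m
  mem_or : m ∈ M ∨ m ∉ v :: L
  notMem : m ∉ K
  not_attached : ∀ z, z = y ∨ z = m → ¬ Attached G K z
  detour : ∃ F, Detour G v L y m M m l F

theorem TightCycle.exists_spur (h : TightCycle G a v b L K) {A D : List V} {x y z : V}
    (hL : L = A ++ y :: z :: D) (hA : ListWalk G A b x) (hx : Attached G K x) :
    ∃ y m M E l, Spur G v b L K x y m A M E l := by
  have hwL := h.walk
  rw [hL] at hwL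
  obtain ⟨u, w, h1, h2, h3⟩ := hwL.split hA.ne_nil (by simp)
  obtain rfl : w = y := by have := h2.2.1; simpa using this.symm
  have hzw := h2.tail.1
  have hadj : G.Adj w z := by
    have := h2.1
    simp only [List.isChain_cons_cons] at this
    exact this.1
  have hy : ¬ Attached G K w := h.not_attached_succ hL hA h2 hx
  by_cases hr : ∃ r, r ∉ v :: L ∧ G.Adj w r
  · obtain ⟨r, hr, hwr⟩ := hr
    have hwC : w ∈ v :: L := by rw [hL]; simp
    have hrK : r ∉ K := fun hrK => hy ⟨r, hrK, hwr⟩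
    refine ⟨w, r, [w], z :: D, w, hL, hA, hx, hwr, .singleton .., by simp, Or.inr hr, hrK, ?_,
      [r, w],
      (ListWalk.singleton ..).cons hwr.symm, by simpa using hwr.ne.symm, by simp [or_comm], by simp⟩
    rintro u (rfl | rfl)
    · exact hy
    · rintro ⟨k, hk, hkr⟩
      rcases h.closed k hk _ hkr.symm with h' | h'
      · exact hrK h'
      · exact hr h'
  · have hz : ¬ Attached G K z := fun hz => hr (h.exists_off_of_attached hL hA hzw hx hz)
    have hzC : z ∈ v :: L := by rw [hL]; simp
    refine ⟨w, z, [w, z], D, z, hL, hA, hx, hadj, (ListWalk.singleton ..).cons hadj, by simp,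
      by simp, fun hzK => h.off z hzK hzC, ?_, [z], .singleton .., by simp, by simp, ?_⟩
    · rintro u (rfl | rfl) <;> assumption
    · intro u hu hu'
      refine ⟨by simp at hu hu'; tauto, fun w' hw' => ?_⟩
      by_contra hcon
      exact hr ⟨w', hcon, hw'⟩

theorem TightCycle.exists_attached_notMem (h : TightCycle G a v b L K) :
    ∃ x ∈ L, Attached G K x ∧ x ≠ a ∧ x ≠ b := by
  by_contra! hcon
  obtain ⟨u, hu⟩ : ∃ u ∈ L, u ≠ a ∧ u ≠ b := by
    by_contra! hc
    have h1 : L.toFinset ⊆ {a, b} := by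
      intro z hz
      have := hc z (List.mem_toFinset.1 hz)
      simp; tauto
    have h2 := Finset.card_le_card h1
    rw [List.toFinset_card_of_nodup h.nodup] at h2
    have := h.len
    have := Finset.card_le_two (a := a) (b := b)
    omega
  have h1 : ClosedOff G {a, v, b} K := by
    refine ⟨?_, ?_⟩
    · rw [Finset.disjoint_right]
      intro z hz hzK
      refine h.off z hzK ?_
      simp only [Finset.mem_insert, Finset.mem_singleton] at hz
      rcases hz with rfl | rfl | rfl
      · simp [h.walk.right_mem]
      · simp
      · simp [h.walk.left_mem]
    · intro z hz w hzw
      rcases h.closed z hz w hzw with h' | h'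
      · exact Or.inl h'
      · right
        rcases List.mem_cons.1 h' with rfl | hw
        · simp
        · have := hcon w hw ⟨z, hz, hzw.symm⟩
          simp; tauto
  rcases h.nonSep K h1 h.nonempty u with h' | h'
  · exact h.off u h' (by simp [hu.1])
  · simp only [Finset.mem_insert, Finset.mem_singleton] at h'
    have := h.notMem
    rcases h' with rfl | rfl | rfl
    · exact hu.2.1 rfl
    · exact this hu.1
    · exact hu.2.2 rfl

theorem TightCycle.three_le_card (h : TightCycle G a v b L K)
    (hconn : ∀ S : Finset V, S.card < 3 → NonSeparating G S) {N : Finset V}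
    (hN : ∀ u, u ∈ N ↔ u ∈ v :: L ∧ Attached G K u) : 3 ≤ N.card := by
  by_contra! hcard
  have h1 : ClosedOff G N K := by
    refine ⟨?_, ?_⟩
    · rw [Finset.disjoint_right]
      exact fun z hz hzK => h.off z hzK ((hN z).1 hz).1
    · intro z hz w hzw
      rcases h.closed z hz w hzw with h' | h'
      · exact Or.inl h'
      · exact Or.inr ((hN w).2 ⟨h', z, hz, hzw.symm⟩)
  have h2 : (v :: L).toFinset ⊆ N := by
    intro z hz
    rw [List.mem_toFinset] at hz
    exact (hconn N hcard K h1 h.nonempty z).resolve_left fun h' => h.off z h' hz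
  have h3 := Finset.card_le_card h2
  rw [List.toFinset_card_of_nodup (List.nodup_cons.2 ⟨h.notMem, h.nodup⟩)] at h3
  have := h.len
  simp at h3
  omega

end

theorem ListWalk.replace_prefix {G : SimpleGraph V} {M F B : List V} {y z l f : V}
    (h : ListWalk G (M ++ B) y z) (hM : ListWalk G M y l) (hF : ListWalk G F f l) :
    ListWalk G (F ++ B) f z := by
  by_cases hB : B = []
  · subst hB
    simp only [List.append_nil] at h ⊢
    obtain rfl : z = l := Option.some.inj (h.2.2.symm.trans hM.2.2)
    exact hF
  · obtain ⟨u, w, h1, h2, h3⟩ := h.split hM.ne_nil hB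
    obtain rfl : u = l := Option.some.inj (h1.2.2.symm.trans hM.2.2)
    exact hF.append h2 h3

theorem ListWalk.split_pair {G : SimpleGraph V} {A B : List V} {x y s t : V}
    (h : ListWalk G (A ++ s :: t :: B) x y) :
    ListWalk G (A ++ [s]) x s ∧ ListWalk G (t :: B) t y ∧ G.Adj s t := by
  have h' : ListWalk G ((A ++ [s]) ++ (t :: B)) x y := by simpa using h
  obtain ⟨u, w, h1, h2, h3⟩ := h'.split (by simp) (by simp)
  have e1 : s = u := by simpa using h1.2.2
  have e2 : t = w := by simpa using h2.2.1
  subst e1 e2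
  exact ⟨h1, h2, h3⟩

section

variable {G : SimpleGraph V} {a v b : V} {L : List V} {K : Finset V}
  {x y m x' y' m' l l' f f' : V} {A M B M' E F F' : List V}

theorem Spur.nodup (h : Spur G v b L K x y m A M E l) (hL : L.Nodup) : M.Nodup := by
  rw [h.eq] at hL
  exact (hL.of_append_right).of_append_left

theorem Spur.detour_self (h : Spur G v b L K x y m A M E l) (hL : L.Nodup) :
    Detour G v L y m M y l M :=
  ⟨h.walk, h.nodup hL, h.sub, fun _ hz hz' => absurd hz hz'⟩

theorem Spur.exists_detour (h : Spur G v b L K x y m A M E l) (hL : L.Nodup)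
    (hf : f = y ∨ f = m) : ∃ F, Detour G v L y m M f l F := by
  rcases hf with rfl | rfl
  · exact ⟨M, h.detour_self hL⟩
  · exact h.detour

theorem Spur.mem_or_of (h : Spur G v b L K x y m A M E l) {z : V} (hz : z = y ∨ z = m) :
    z ∈ M ∨ z ∉ v :: L := by
  rcases hz with rfl | rfl
  · exact Or.inl h.walk.left_mem
  · exact h.mem_or

theorem Spur.mem_tail (h : Spur G v b L K x y m A M E l) {z : V} (hz : z ∈ M) : z ∈ v :: L := by
  rw [h.eq]; simp [hz]

theorem Spur.notMem_of (h : Spur G v b L K x y m A M E l) (hK : ∀ u ∈ K, u ∉ v :: L)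
    {z : V} (hz : z = y ∨ z = m) : z ∉ K := by
  rcases hz with rfl | rfl
  · exact fun hz => hK _ hz (h.mem_tail h.walk.left_mem)
  · exact h.notMem

variable [DecidableEq V]

/-- Two spurs, the second one starting after the end of the first one. -/
structure SpurPair (G : SimpleGraph V) (a v b : V) (L : List V) (K : Finset V)
    (x y m : V) (A M B : List V) (l x' y' m' : V) (M' E : List V) (l' : V) : Prop where
  cycle : TightCycle G a v b L K
  fst : Spur G v b L K x y m A M (B ++ (M' ++ E)) l
  snd : Spur G v b L K x' y' m' (A ++ (M ++ B)) M' E l'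

theorem SpurPair.eq
    (h : SpurPair G a v b L K x y m A M B l x' y' m' M' E l') :
    L = A ++ (M ++ (B ++ (M' ++ E))) := h.fst.eq

theorem SpurPair.walk_mid
    (h : SpurPair G a v b L K x y m A M B l x' y' m' M' E l') : ListWalk G (M ++ B) y x' := by
  have h1 := h.snd.walk_left
  obtain ⟨u, w, h2, h3, h4⟩ := h1.split h.fst.walk_left.ne_nil (by simp [h.fst.walk.ne_nil])
  have := h3.2.1
  obtain ⟨t, rfl⟩ := h.fst.walk.eq_cons
  obtain rfl : y = w := by simpa using this
  exact h3

theorem SpurPair.walk_right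
    (h : SpurPair G a v b L K x y m A M B l x' y' m' M' E l') : ListWalk G (M' ++ E) y' a := by
  have h1 := h.cycle.walk
  rw [h.snd.eq] at h1
  obtain ⟨u, w, h2, h3, h4⟩ := h1.split h.snd.walk_left.ne_nil (by simp [h.snd.walk.ne_nil])
  have := h3.2.1
  obtain ⟨t, rfl⟩ := h.snd.walk.eq_cons
  obtain rfl : y' = w := by simpa using this
  exact h3

theorem SpurPair.false_of_perm
    (h : SpurPair G a v b L K x y m A M B l x' y' m' M' E l')
    (hF : Detour G v L y m M f l F) (hF' : Detour G v L y' m' M' f' l' F')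
    (hFF : ∀ z ∈ F, z ∉ F') {P D L' : List V} (hP : P.Nodup) (hP0 : P ≠ []) (hPK : ∀ z ∈ P, z ∈ K)
    (hD : D.Nodup) (hDL : ∀ z ∈ D, z ∉ v :: L) (hDK : ∀ z ∈ D, z ∉ K) (hDF : ∀ z ∈ D, z ∉ F)
    (hDF' : ∀ z ∈ D, z ∉ F') (hskip : ¬ G.Adj y y' ∨ F = M ∧ F' = M')
    (hL' : L'.Perm (A ++ (P ++ (F ++ (B ++ (F' ++ (E ++ D))))))) (hw : ListWalk G L' b a) :
    False := by
  have hmem : ∀ z, z ∈ L' ↔ z ∈ A ∨ z ∈ P ∨ z ∈ F ∨ z ∈ B ∨ z ∈ F' ∨ z ∈ E ∨ z ∈ D := by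
    intro z; rw [hL'.mem_iff]; simp
  have hn := h.cycle.nodup
  have hv := h.cycle.notMem
  have hoff := h.cycle.off
  have hF1 : ∀ z ∈ F, (z ∈ M ∨ z ∉ v :: L) ∧ z ∉ K := fun z hz =>
    ⟨h.fst.mem_or_of (hF.sub z hz), h.fst.notMem_of hoff (hF.sub z hz)⟩
  have hF2 : ∀ z ∈ F', (z ∈ M' ∨ z ∉ v :: L) ∧ z ∉ K := fun z hz =>
    ⟨h.snd.mem_or_of (hF'.sub z hz), h.snd.notMem_of hoff (hF'.sub z hz)⟩
  have hvF : v ∉ F ∧ v ∉ F' ∧ v ∉ K ∧ v ∉ D := by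
    refine ⟨fun hz => ?_, fun hz => ?_, fun hz => hoff v hz (by simp), fun hz => hDL v hz (by simp)⟩
    · rcases (hF1 v hz).1 with h' | h'
      · exact hv (by rw [h.eq]; simp [h'])
      · exact h' (by simp)
    · rcases (hF2 v hz).1 with h' | h'
      · exact hv (by rw [h.eq]; simp [h'])
      · exact h' (by simp)
  have eq := h.eq
  have hmemL : ∀ z, z ∈ L ↔ z ∈ A ∨ z ∈ M ∨ z ∈ B ∨ z ∈ M' ∨ z ∈ E := by
    intro z; rw [eq]; simp
  rw [eq] at hn
  refine h.cycle.not_reroute hw (hL'.nodup_iff.2 ?_) ?_ ?_ ?_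
  · have hnF := hF.nodup
    have hnF' := hF'.nodup
    simp only [List.mem_cons, hmemL] at hDL hF1 hF2 hoff
    simp only [List.nodup_append, List.mem_append] at hn ⊢
    obtain ⟨nA, ⟨nM, ⟨nB, ⟨nM', nE, d1⟩, d2⟩, d3⟩, d4⟩ := hn
    refine ⟨nA, ⟨hP, ⟨hnF, ⟨nB, ⟨hnF', ⟨nE, hD, ?_⟩, ?_⟩, ?_⟩, ?_⟩, ?_⟩, ?_⟩
    all_goals grind
  · rw [hmem]
    rw [hmemL] at hv
    have : v ∉ P := fun hz => hvF.2.2.1 (hPK v hz)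
    grind
  · obtain ⟨t, P', rfl⟩ := List.exists_cons_of_ne_nil hP0
    exact ⟨t, hPK t (by simp), (hmem t).2 (by simp)⟩
  · have key : ∀ z ∈ L, z ∉ L' → z ∈ M ∧ z ∉ F ∨ z ∈ M' ∧ z ∉ F' := by
      intro z hz hz'
      rw [hmemL] at hz
      rw [hmem] at hz'
      grind
    have main : ∀ w, w ∈ v :: L → w ≠ y → w ≠ y' → w ∈ v :: L' := by
      intro w hw1 hw2 hw3
      rw [List.mem_cons] at hw1 ⊢
      by_contra hcon
      push Not at hcon
      rcases key w (hw1.resolve_left hcon.1) hcon.2 with ⟨h1, h2⟩ | ⟨h1, h2⟩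
      · exact hw2 (hF.skip w h1 h2).1
      · exact hw3 (hF'.skip w h1 h2).1
    intro u hu hu' w huw
    rcases key u hu hu' with ⟨hM, hMF⟩ | ⟨hM, hMF⟩
    · obtain ⟨rfl, h2⟩ := hF.skip u hM hMF
      refine main w (h2 w huw) huw.ne.symm ?_
      rintro rfl
      rcases hskip with h3 | ⟨rfl, rfl⟩
      · exact h3 huw
      · exact hMF hM
    · obtain ⟨rfl, h2⟩ := hF'.skip u hM hMF
      refine main w (h2 w huw) ?_ huw.ne.symm
      rintro rfl
      rcases hskip with h3 | ⟨rfl, rfl⟩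
      · exact h3 huw.symm
      · exact hMF hM

theorem SpurPair.disjoint_mid
    (h : SpurPair G a v b L K x y m A M B l x' y' m' M' E l') : ∀ z ∈ M, z ∉ M' := by
  have hn := h.cycle.nodup
  rw [h.eq] at hn
  simp only [List.nodup_append, List.mem_append] at hn
  intro z hz hz'
  grind

theorem SpurPair.not_adj_fst
    (h : SpurPair G a v b L K x y m A M B l x' y' m' M' E l') : ¬ G.Adj y y' := by
  intro hadj
  obtain ⟨P, p, q, hP, hxp, hqy, hPn, hPK⟩ := h.cycle.exists_path h.fst.attached h.snd.attached
  refine h.false_of_perm (h.fst.detour_self h.cycle.nodup) (h.snd.detour_self h.cycle.nodup)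
    h.disjoint_mid hPn hP.ne_nil hPK (D := []) (by simp) (by simp) (by simp) (by simp) (by simp)
    (Or.inr ⟨rfl, rfl⟩) (L' := A ++ (P ++ ((M ++ B).reverse ++ (M' ++ E)))) ?_
    (h.fst.walk_left.append (hP.append (h.walk_mid.reverse.append h.walk_right hadj) hqy) hxp)
  rw [List.perm_iff_count]; intro z; simp; omega

theorem SpurPair.ne_of_mem
    (h : SpurPair G a v b L K x y m A M B l x' y' m' M' E l')
    {z w : V} (hz : z = y ∨ z = m) (hw : w = y' ∨ w = m') : z ≠ w := by
  have key : ∀ u, u ∈ M ∨ u ∈ M' → u ∈ v :: L := by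
    intro u hu; rw [h.eq]; simp; tauto
  have hd := h.disjoint_mid
  rintro rfl
  have h1 := h.fst.mem_or_of hz
  have h2 := h.snd.mem_or_of hw
  have hzC : z ∉ v :: L := by
    intro hzC
    exact hd z (h1.resolve_right (by tauto)) (h2.resolve_right (by tauto))
  have e1 : z = m := hz.resolve_left fun e => hzC (e ▸ key y (Or.inl h.fst.walk.left_mem))
  have e2 : z = m' := hw.resolve_left fun e => hzC (e ▸ key y' (Or.inr h.snd.walk.left_mem))
  obtain ⟨P, p, q, hP, hxp, hqy, hPn, hPK⟩ := h.cycle.exists_path h.fst.attached h.snd.attached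
  refine h.false_of_perm (h.fst.detour_self h.cycle.nodup) (h.snd.detour_self h.cycle.nodup)
    h.disjoint_mid hPn hP.ne_nil hPK (D := [z]) (by simp) (by simpa using hzC)
    (by simpa [e1] using h.fst.notMem) ?_ ?_
    (Or.inr ⟨rfl, rfl⟩) (L' := A ++ (P ++ ((M ++ B).reverse ++ (z :: (M' ++ E))))) ?_
    (h.fst.walk_left.append (hP.append (h.walk_mid.reverse.append
      (h.walk_right.cons (e2 ▸ h.snd.adj.symm)) (e1 ▸ h.fst.adj)) hqy) hxp)
  · simp only [List.mem_singleton]; rintro u rfl hu; exact hzC (key u (Or.inl hu))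
  · simp only [List.mem_singleton]; rintro u rfl hu; exact hzC (key u (Or.inr hu))
  · rw [List.perm_iff_count]; intro z; simp [List.count_cons]; omega

theorem SpurPair.exists_rearrangement
    (h : SpurPair G a v b L K x y m A M B l x' y' m' M' E l')
    (hf : f = y ∨ f = m) (hf' : f' = y' ∨ f' = m') :
    ∃ P p q F F', ListWalk G P p q ∧ G.Adj x p ∧ G.Adj q x' ∧ ListWalk G (F ++ B) f x' ∧
      ListWalk G (F' ++ E) f' a ∧ ListWalk G F f l ∧ ListWalk G F' f' l' ∧
      ∀ L' D : List V, D.Nodup → (∀ z ∈ D, z ∉ v :: L ∧ z ∉ K ∧ z ≠ y ∧ z ≠ m ∧ z ≠ y' ∧ z ≠ m') →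
        L'.Perm (A ++ (P ++ (F ++ (B ++ (F' ++ (E ++ D)))))) → ¬ ListWalk G L' b a := by
  obtain ⟨P, p, q, hP, hxp, hqy, hPn, hPK⟩ := h.cycle.exists_path h.fst.attached h.snd.attached
  obtain ⟨F, hF⟩ := h.fst.exists_detour h.cycle.nodup hf
  obtain ⟨F', hF'⟩ := h.snd.exists_detour h.cycle.nodup hf'
  refine ⟨P, p, q, F, F', hP, hxp, hqy, h.walk_mid.replace_prefix h.fst.walk hF.walk,
    h.walk_right.replace_prefix h.snd.walk hF'.walk, hF.walk, hF'.walk, ?_⟩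
  intro L' D hD hD' hp hw
  refine h.false_of_perm hF hF' (fun z hz hz' => h.ne_of_mem (hF.sub z hz) (hF'.sub z hz') rfl)
    hPn hP.ne_nil hPK hD (fun z hz => (hD' z hz).1) (fun z hz => (hD' z hz).2.1) ?_ ?_
    (Or.inl h.not_adj_fst) hp hw
  · intro z hz hz'
    have := hF.sub z hz'
    have := hD' z hz
    tauto
  · intro z hz hz'
    have := hF'.sub z hz'
    have := hD' z hz
    tauto

theorem SpurPair.not_adj
    (h : SpurPair G a v b L K x y m A M B l x' y' m' M' E l')
    (hf : f = y ∨ f = m) (hf' : f' = y' ∨ f' = m') : ¬ G.Adj f f' := by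
  intro hadj
  obtain ⟨P, p, q, F, F', hP, hxp, hqy, hB, hE, -, -, hno⟩ := h.exists_rearrangement hf hf'
  refine hno (A ++ (P ++ ((F ++ B).reverse ++ (F' ++ E)))) [] (by simp) (by simp) ?_
    (h.fst.walk_left.append (hP.append (hB.reverse.append hE hadj) hqy) hxp)
  rw [List.perm_iff_count]; intro z; simp; omega

theorem SpurPair.not_adj_off
    (h : SpurPair G a v b L K x y m A M B l x' y' m' M' E l')
    {u : V} (hu : u ∉ v :: L) (huK : u ∉ K)
    (hu1 : u ≠ y ∧ u ≠ m ∧ u ≠ y' ∧ u ≠ m') (hf : f = y ∨ f = m) (hf' : f' = y' ∨ f' = m')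
    (h1 : G.Adj u f) : ¬ G.Adj u f' := by
  intro h2
  obtain ⟨P, p, q, F, F', hP, hxp, hqy, hB, hE, -, -, hno⟩ := h.exists_rearrangement hf hf'
  refine hno (A ++ (P ++ ((F ++ B).reverse ++ (u :: (F' ++ E))))) [u] (by simp)
    (by simp only [List.mem_singleton, forall_eq]; exact ⟨hu, huK, hu1⟩) ?_
    (h.fst.walk_left.append (hP.append (hB.reverse.append (hE.cons h2) h1.symm) hqy) hxp)
  rw [List.perm_iff_count]; intro z; simp [List.count_cons]; omega

theorem SpurPair.chain_mid
    (h : SpurPair G a v b L K x y m A M B l x' y' m' M' E l') :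
    (l :: B).IsChain fun s t => ∀ f f', (f = y ∨ f = m) →
    (f' = y' ∨ f' = m') → G.Adj s f' → ¬ G.Adj t f := by
  rw [List.isChain_iff_forall_rel_of_append_cons_cons]
  intro s t σ τ heq f f' hf hf' h1 h2
  obtain ⟨P, p, q, F, F', hP, hxp, hqy, hB, hE, hF, -, hno⟩ := h.exists_rearrangement hf hf'
  obtain ⟨F0, rfl⟩ := hF.eq_concat
  have e : F0 ++ [l] ++ B = (F0 ++ σ) ++ s :: t :: τ := by simp [heq]
  rw [e] at hB
  obtain ⟨w1, w2, -⟩ := hB.split_pair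
  refine hno (A ++ (P ++ ((t :: τ).reverse ++ (((F0 ++ σ) ++ [s]) ++ (F' ++ E))))) []
    (by simp) (by simp) ?_
    (h.fst.walk_left.append (hP.append (w2.reverse.append (w1.append hE h1) h2) hqy) hxp)
  rw [List.perm_iff_count]; intro z
  have := congrArg (List.count z) e
  simp [List.count_cons] at this ⊢; omega

theorem SpurPair.chain_right
    (h : SpurPair G a v b L K x y m A M B l x' y' m' M' E l') :
    (l' :: E).IsChain fun s t => ∀ f f', (f = y ∨ f = m) →
    (f' = y' ∨ f' = m') → G.Adj s f → ¬ G.Adj t f' := by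
  rw [List.isChain_iff_forall_rel_of_append_cons_cons]
  intro s t σ τ heq f f' hf hf' h1 h2
  obtain ⟨P, p, q, F, F', hP, hxp, hqy, hB, hE, -, hF, hno⟩ := h.exists_rearrangement hf hf'
  obtain ⟨F0, rfl⟩ := hF.eq_concat
  have e : F0 ++ [l'] ++ E = (F0 ++ σ) ++ s :: t :: τ := by simp [heq]
  rw [e] at hE
  obtain ⟨w1, w2, -⟩ := hE.split_pair
  refine hno (A ++ (P ++ ((F ++ B).reverse ++ (((F0 ++ σ) ++ [s]).reverse ++ (t :: τ))))) []
    (by simp) (by simp) ?_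
    (h.fst.walk_left.append (hP.append (hB.reverse.append (w1.reverse.append w2 h2.symm)
      h1.symm) hqy) hxp)
  rw [List.perm_iff_count]; intro z
  have := congrArg (List.count z) e
  simp [List.count_cons] at this ⊢; omega

theorem SpurPair.chain_left
    (h : SpurPair G a v b L K x y m A M B l x' y' m' M' E l') :
    A.IsChain fun s t => ∀ f f', (f = y ∨ f = m) →
    (f' = y' ∨ f' = m') → G.Adj s f → ¬ G.Adj t f' := by
  rw [List.isChain_iff_forall_rel_of_append_cons_cons]
  intro s t σ τ heq f f' hf hf' h1 h2
  obtain ⟨P, p, q, F, F', hP, hxp, hqy, hB, hE, -, hF, hno⟩ := h.exists_rearrangement hf hf'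
  have hA := h.fst.walk_left
  rw [heq] at hA
  obtain ⟨w1, w2, -⟩ := hA.split_pair
  refine hno ((σ ++ [s]) ++ ((F ++ B) ++ (P.reverse ++ ((t :: τ).reverse ++ (F' ++ E))))) []
    (by simp) (by simp) ?_
    (w1.append (hB.append (hP.reverse.append (w2.reverse.append hE h2) hxp.symm) hqy.symm) h1)
  rw [List.perm_iff_count]; intro z
  have := congrArg (List.count z) heq
  simp [List.count_cons] at this ⊢; omega

end

open Classical in
/-- The indicator of the vertices counted by `edgeDeg G e f`. -/
noncomputable def touch (G : SimpleGraph V) (e f u : V) : ℕ :=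
  if u ≠ e ∧ u ≠ f ∧ (G.Adj u e ∨ G.Adj u f) then 1 else 0

theorem touch_le_one (G : SimpleGraph V) (e f u : V) : touch G e f u ≤ 1 := by
  unfold touch; split_ifs <;> simp

theorem touch_eq_zero_of_not_adj {G : SimpleGraph V} {e f u : V} (h1 : ¬ G.Adj u e)
    (h2 : ¬ G.Adj u f) : touch G e f u = 0 := by
  unfold touch; rw [if_neg]; tauto

theorem touch_eq_zero_of_mem {G : SimpleGraph V} {e f u : V} (h : u = e ∨ u = f) :
    touch G e f u = 0 := by
  unfold touch; rw [if_neg]; tauto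

theorem exists_adj_of_touch {G : SimpleGraph V} {e f u : V} (h : touch G e f u ≠ 0) :
    ∃ z, (z = e ∨ z = f) ∧ G.Adj u z := by
  by_contra! hcon
  exact h (touch_eq_zero_of_not_adj (hcon e (Or.inl rfl)) (hcon f (Or.inr rfl)))

theorem edgeDeg_eq_sum [Fintype V] (G : SimpleGraph V) (e f : V) :
    edgeDeg G e f = ∑ u, touch G e f u := by
  classical
  unfold edgeDeg touch
  rw [Finset.sum_boole, Nat.cast_id, ← Set.ncard_coe_finset]
  congr 1
  ext u
  simp [G.adj_comm u]
  tauto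

theorem List.IsChain.sum_le {α : Type*} {f g c : α → ℕ} {s : α} {l : List α}
    (h : (s :: l).IsChain fun s t => f s + g t ≤ c t) {z : α} (hz : z ∈ (s :: l).getLast?) :
    (l.map fun u => f u + g u).sum + f s ≤ (l.map c).sum + f z := by
  induction l generalizing s with
  | nil =>
    obtain rfl : s = z := by simpa using hz
    simp
  | cons t l ih =>
    rw [List.isChain_cons_cons] at h
    have := ih h.2 (by simpa using hz)
    simp only [List.map_cons, List.sum_cons]
    omega

theorem List.exists_spur_index {α : Type*} {R : List α} {x p a : α} (hx : x ∈ R ++ [p, a])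
    (hp : x ≠ p) (ha : x ≠ a) : ∃ A y z D, R ++ [p, a] = (A ++ [x]) ++ y :: z :: D := by
  have hx : x ∈ R := by simpa [hp, ha] using hx
  obtain ⟨A, B, rfl⟩ := List.append_of_mem hx
  rcases B with _ | ⟨y, _ | ⟨z, D⟩⟩
  · exact ⟨A, p, a, [], by simp⟩
  · exact ⟨A, y, p, [a], by simp⟩
  · exact ⟨A, y, z, D ++ [p, a], by simp⟩

section

variable [DecidableEq V] {G : SimpleGraph V} {a v b : V} {L : List V} {K : Finset V}
  {x y m x' y' m' l l' : V} {A M B M' E A' E' : List V}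

theorem TightCycle.exists_spur_of_mem (h : TightCycle G a v b L K) {R : List V} {p : V}
    (hR : L = R ++ [p, a]) (hx : x ∈ L) (hp : x ≠ p) (ha : x ≠ a) (hxK : Attached G K x) :
    ∃ y m A M E l, Spur G v b L K x y m A M E l := by
  rw [hR] at hx
  obtain ⟨A, y, z, D, heq⟩ := List.exists_spur_index hx hp ha
  have hw := h.walk
  rw [hR, heq, List.append_assoc, List.singleton_append] at hw
  obtain ⟨y, m, M, E, l, hs⟩ := h.exists_spur (hR.trans heq) (ListWalk.split_at.1 hw).1 hxK
  exact ⟨y, m, _, M, E, l, hs⟩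

theorem Spur.pair_of_lt (h : TightCycle G a v b L K) (hs : Spur G v b L K x y m A M E l)
    (hs' : Spur G v b L K x' y' m' A' M' E' l') {P Q C : List V}
    (hL : L = P ++ x :: (Q ++ x' :: C)) :
    ∃ B, SpurPair G a v b L K x y m A M B l x' y' m' M' E' l' := by
  obtain ⟨α, rfl⟩ := hs.walk_left.eq_concat
  obtain ⟨α', rfl⟩ := hs'.walk_left.eq_concat
  have hn := h.nodup
  have e1 : P ++ x :: (Q ++ x' :: C) = α ++ x :: (M ++ E) := by
    rw [← hL, hs.eq]; simp
  have hnx : x ∉ P ∧ x ∉ Q ++ x' :: C := by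
    rw [hL] at hn
    simp only [List.nodup_append, List.nodup_cons] at hn
    refine ⟨fun hx => hn.2.2 x hx x (by simp) rfl, hn.2.1.1⟩
  obtain ⟨-, -, e2⟩ := (List.append_cons_inj_of_notMem hnx.1 hnx.2).1 e1
  have hx'M : x' ∉ M := fun hx' => hs.not_attached x' (hs.sub x' hx') hs'.attached
  have hx'E : x' ∈ E := by
    have : x' ∈ M ++ E := by rw [← e2]; simp
    exact (List.mem_append.1 this).resolve_left hx'M
  obtain ⟨ρ, E1, rfl⟩ := List.append_of_mem hx'E
  have e3 : (α ++ [x] ++ (M ++ ρ)) ++ x' :: E1 = α' ++ x' :: (M' ++ E') := by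
    have h1 := hs.eq.symm.trans hs'.eq
    simpa using h1
  have hnx' : x' ∉ α ++ [x] ++ (M ++ ρ) ∧ x' ∉ E1 := by
    rw [hs.eq] at hn
    have e4 : α ++ [x] ++ (M ++ (ρ ++ x' :: E1)) = (α ++ [x] ++ (M ++ ρ)) ++ x' :: E1 := by simp
    rw [e4, List.nodup_append, List.nodup_cons] at hn
    exact ⟨fun hx => hn.2.2 x' hx x' (by simp) rfl, hn.2.1.1⟩
  obtain ⟨rfl, -, rfl⟩ := (List.append_cons_inj_of_notMem hnx'.1 hnx'.2).1 e3
  refine ⟨ρ ++ [x'], h, ?_, ?_⟩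
  · simpa using hs
  · simpa using hs'

theorem Spur.exists_pair (h : TightCycle G a v b L K) (hs : Spur G v b L K x y m A M E l)
    (hs' : Spur G v b L K x' y' m' A' M' E' l') (hne : x ≠ x') :
    (∃ B, SpurPair G a v b L K x y m A M B l x' y' m' M' E' l') ∨
      ∃ B, SpurPair G a v b L K x' y' m' A' M' B l' x y m M E l := by
  have hx : x ∈ L := by rw [hs.eq]; simp [hs.walk_left.right_mem]
  have hx' : x' ∈ L := by rw [hs'.eq]; simp [hs'.walk_left.right_mem]
  obtain ⟨P, Q, C, hL | hL⟩ := List.exists_eq_of_mem_of_mem hx hx' hne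
  · exact Or.inl (hs.pair_of_lt h hs' hL)
  · exact Or.inr (hs'.pair_of_lt h hs hL)

theorem Spur.remote_inner (hC : TightCycle G a v b L K) (h : Spur G v b L K x y m A M E l)
    {k k' : V} (hk : k ∈ K) (hk' : k' ∈ K) : Remote G (k, k') (y, m) := by
  have hy : y ∉ K := h.notMem_of hC.off (Or.inl rfl)
  have hm : m ∉ K := h.notMem
  have h1 := h.not_attached y (Or.inl rfl)
  have h2 := h.not_attached m (Or.inr rfl)
  have key : ∀ s ∈ K, ∀ t, ¬ Attached G K t → ¬ G.Adj s t :=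
    fun s hs t ht hst => ht ⟨s, hs, hst.symm⟩
  refine ⟨?_, ?_, ?_, ?_, key _ hk _ h1, key _ hk _ h2, key _ hk' _ h1, key _ hk' _ h2⟩
  all_goals (rintro rfl; contradiction)

theorem SpurPair.remote
    (h : SpurPair G a v b L K x y m A M B l x' y' m' M' E l') : Remote G (y, m) (y', m') :=
  ⟨h.ne_of_mem (Or.inl rfl) (Or.inl rfl), h.ne_of_mem (Or.inl rfl) (Or.inr rfl),
    h.ne_of_mem (Or.inr rfl) (Or.inl rfl), h.ne_of_mem (Or.inr rfl) (Or.inr rfl),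
    h.not_adj (Or.inl rfl) (Or.inl rfl), h.not_adj (Or.inl rfl) (Or.inr rfl),
    h.not_adj (Or.inr rfl) (Or.inl rfl), h.not_adj (Or.inr rfl) (Or.inr rfl)⟩

theorem SpurPair.touch_fst
    (h : SpurPair G a v b L K x y m A M B l x' y' m' M' E l')
    {z : V} (hz : (z = y ∨ z = m) ∨ (z = y' ∨ z = m')) :
    touch G y m z = 0 := by
  rcases hz with hz | hz
  · exact touch_eq_zero_of_mem hz
  · exact touch_eq_zero_of_not_adj (fun h' => h.not_adj (Or.inl rfl) hz h'.symm)
      (fun h' => h.not_adj (Or.inr rfl) hz h'.symm)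

theorem SpurPair.touch_snd
    (h : SpurPair G a v b L K x y m A M B l x' y' m' M' E l')
    {z : V} (hz : (z = y ∨ z = m) ∨ (z = y' ∨ z = m')) :
    touch G y' m' z = 0 := by
  rcases hz with hz | hz
  · exact touch_eq_zero_of_not_adj (h.not_adj hz (Or.inl rfl)) (h.not_adj hz (Or.inr rfl))
  · exact touch_eq_zero_of_mem hz

theorem SpurPair.edgeDeg_add_le
    (h : SpurPair G a v b L K x y m A M B l x' y' m' M' E l')
    [Fintype V] {k k' : V} (hk : k ∈ K) (hk' : k' ∈ K)
    (hkk : G.Adj k k') :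
    edgeDeg G k k' + edgeDeg G y m + edgeDeg G y' m' + 6 ≤ Fintype.card V +
      (touch G y m v + touch G y' m' v + touch G y' m' b + touch G y m a) +
      ∑ u ∈ (v :: L).toFinset, touch G k k' u := by
  classical
  have hC := h.cycle
  have hr1 := h.fst.remote_inner hC hk hk'
  have hr2 := h.snd.remote_inner hC hk hk'
  have hr := h.remote
  set S : Finset V := {k, k', y, m, y', m'} with hS
  have hScard : S.card = 6 := by
    have := h.fst.adj.ne
    have := h.snd.adj.ne
    have := hkk.ne
    obtain ⟨h1, h2, h3, h4, -⟩ := hr1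
    obtain ⟨h1', h2', h3', h4', -⟩ := hr2
    obtain ⟨g1, g2, g3, g4, -⟩ := hr
    simp only at h1 h2 h3 h4 h1' h2' h3' h4' g1 g2 g3 g4
    rw [hS, Finset.card_insert_of_notMem, Finset.card_insert_of_notMem,
      Finset.card_insert_of_notMem, Finset.card_insert_of_notMem, Finset.card_pair]
    all_goals simp; try tauto
  set c : V → ℕ := fun u => if u ∈ S then 0 else 1 with hc
  have hcsum : ∑ u, c u + 6 = Fintype.card V := by
    have : ∀ u, c u = if u ∈ Sᶜ then 1 else 0 := by
      intro u; simp only [hc, Finset.mem_compl]; split_ifs <;> rfl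
    simp_rw [this]
    rw [Finset.sum_ite_mem, Finset.univ_inter]
    have := Finset.card_compl_add_card S
    simp; omega
  have hmem : ∀ u, u ∈ S ↔ u = k ∨ u = k' ∨ u = y ∨ u = m ∨ u = y' ∨ u = m' := by
    intro u; simp [hS]
  have hoff : ∀ u ∉ v :: L, touch G k k' u + (touch G y m u + touch G y' m' u) ≤ c u := by
    intro u hu
    by_cases huS : u ∈ S
    · have h0 : touch G k k' u = 0 ∧ touch G y m u = 0 ∧ touch G y' m' u = 0 := by
        obtain ⟨-, -, -, -, f1, f2, f3, f4⟩ := hr1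
        obtain ⟨-, -, -, -, f1', f2', f3', f4'⟩ := hr2
        simp only at f1 f2 f3 f4 f1' f2' f3' f4'
        rcases (hmem u).1 huS with hu' | hu' | hu' | hu' | hu' | hu'
        · subst hu'
          exact ⟨touch_eq_zero_of_mem (by simp), touch_eq_zero_of_not_adj f1 f2,
            touch_eq_zero_of_not_adj f1' f2'⟩
        · subst hu'
          exact ⟨touch_eq_zero_of_mem (by simp), touch_eq_zero_of_not_adj f3 f4,
            touch_eq_zero_of_not_adj f3' f4'⟩
        all_goals
          refine ⟨?_, h.touch_fst (by tauto), h.touch_snd (by tauto)⟩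
          subst hu'
          apply touch_eq_zero_of_not_adj <;> rw [G.adj_comm] <;> assumption
      omega
    · have hcu : c u = 1 := by simp [hc, huS]
      rw [hcu]
      rw [hmem] at huS
      simp only [not_or] at huS
      obtain ⟨-, -, g1, g2, g3, g4⟩ := huS
      by_cases huK : u ∈ K
      · have e1 : touch G y m u = 0 := touch_eq_zero_of_not_adj
          (fun h' => h.fst.not_attached y (Or.inl rfl) ⟨u, huK, h'.symm⟩)
          (fun h' => h.fst.not_attached m (Or.inr rfl) ⟨u, huK, h'.symm⟩)
        have e2 : touch G y' m' u = 0 := touch_eq_zero_of_not_adj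
          (fun h' => h.snd.not_attached y' (Or.inl rfl) ⟨u, huK, h'.symm⟩)
          (fun h' => h.snd.not_attached m' (Or.inr rfl) ⟨u, huK, h'.symm⟩)
        have := touch_le_one G k k' u
        omega
      · have key : ∀ s ∈ K, ¬ G.Adj u s := fun s hs hus => by
          rcases hC.closed s hs u hus.symm with h' | h'
          · exact huK h'
          · exact hu h'
        have e0 : touch G k k' u = 0 := touch_eq_zero_of_not_adj (key k hk) (key k' hk')
        have e1 : touch G y m u = 0 ∨ touch G y' m' u = 0 := by
          by_contra! hcon
          obtain ⟨f, hf, huf⟩ := exists_adj_of_touch hcon.1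
          obtain ⟨f', hf', huf'⟩ := exists_adj_of_touch hcon.2
          exact h.not_adj_off hu huK ⟨g1, g2, g3, g4⟩ hf hf' huf huf'
        have := touch_le_one G y m u
        have := touch_le_one G y' m' u
        omega
  have hcon : ∀ z ∈ v :: L, z ∉ M → z ∉ M' → c z = 1 := by
    intro z hz hzM hzM'
    have : z ∉ S := by
      rw [hmem]
      have hzK : z ∉ K := fun hz' => hC.off z hz' hz
      have h1 : ∀ w, w = y ∨ w = m → z ≠ w := by
        rintro w hw rfl
        exact (h.fst.mem_or_of hw).elim hzM (fun h' => h' hz)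
      have h2 : ∀ w, w = y' ∨ w = m' → z ≠ w := by
        rintro w hw rfl
        exact (h.snd.mem_or_of hw).elim hzM' (fun h' => h' hz)
      rintro (rfl | rfl | h' | h' | h' | h')
      · exact hzK hk
      · exact hzK hk'
      · exact h1 z (Or.inl h') rfl
      · exact h1 z (Or.inr h') rfl
      · exact h2 z (Or.inl h') rfl
      · exact h2 z (Or.inr h') rfl
    simp [hc, this]
  have hnL : (v :: L).Nodup := List.nodup_cons.2 ⟨hC.notMem, hC.nodup⟩
  have hn := hC.nodup
  have hv := hC.notMem
  have hLmem : ∀ z, z ∈ L ↔ z ∈ A ∨ z ∈ M ∨ z ∈ B ∨ z ∈ M' ∨ z ∈ E := by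
    intro z; rw [h.eq]; simp
  have hdisj : ∀ z, (z ∈ A ∨ z ∈ B ∨ z ∈ E) → c z = 1 := by
    intro z hz
    rw [h.eq] at hn
    simp only [List.nodup_append, List.mem_append] at hn
    apply hcon
    · rw [List.mem_cons, hLmem]; grind
    · intro hzM; grind
    · intro hzM; grind
  have hcv : c v = 1 := by
    rw [hLmem] at hv
    exact hcon v (by simp) (fun h' => hv (.inr (.inl h')))
      fun h' => hv (.inr (.inr (.inr (.inl h'))))
  have le1 := touch_le_one G y m
  have le2 := touch_le_one G y' m'
  have hlist : ((v :: L).map fun u => touch G y m u + touch G y' m' u).sum ≤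
      ((v :: L).map c).sum +
        (touch G y m v + touch G y' m' v + touch G y' m' b + touch G y m a) := by
    have hM : (M.map fun u => touch G y m u + touch G y' m' u).sum = 0 := by
      rw [List.sum_eq_zero]
      simp only [List.mem_map, forall_exists_index, and_imp, forall_apply_eq_imp_iff₂]
      intro z hz
      have := h.fst.sub z hz
      simp [h.touch_fst (Or.inl this), h.touch_snd (Or.inl this)]
    have hM' : (M'.map fun u => touch G y m u + touch G y' m' u).sum = 0 := by
      rw [List.sum_eq_zero]
      simp only [List.mem_map, forall_exists_index, and_imp, forall_apply_eq_imp_iff₂]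
      intro z hz
      have := h.snd.sub z hz
      simp [h.touch_fst (Or.inr this), h.touch_snd (Or.inr this)]
    have hA : (A.map fun u => touch G y m u + touch G y' m' u).sum ≤
        (A.map c).sum + touch G y' m' b := by
      obtain ⟨A1, hA1⟩ := h.fst.walk_left.eq_cons
      have hch : (b :: A1).IsChain fun s t => touch G y m s + touch G y' m' t ≤ c t := by
        rw [← hA1, List.isChain_iff_forall_rel_of_append_cons_cons]
        intro s t σ τ e
        rw [hdisj t (Or.inl (by rw [e]; simp))]
        by_contra hlt
        obtain ⟨f, hf, huf⟩ := exists_adj_of_touch (G := G) (e := y) (f := m) (u := s)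
          (by have := le1 s; have := le2 t; omega)
        obtain ⟨f', hf', huf'⟩ := exists_adj_of_touch (G := G) (e := y') (f := m') (u := t)
          (by have := le1 s; have := le2 t; omega)
        exact List.isChain_iff_forall_rel_of_append_cons_cons.1 h.chain_left e f f' hf hf' huf huf'
      have := hch.sum_le (z := x) (by rw [← hA1]; exact h.fst.walk_left.2.2)
      have h1 := hdisj b (Or.inl h.fst.walk_left.left_mem)
      have := le1 x
      rw [hA1]
      simp only [List.map_cons, List.sum_cons]
      omega
    have hB : (B.map fun u => touch G y m u + touch G y' m' u).sum ≤ (B.map c).sum + 1 := by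
      have hch : (l :: B).IsChain fun s t => touch G y' m' s + touch G y m t ≤ c t := by
        rw [List.isChain_iff_forall_rel_of_append_cons_cons]
        intro s t σ τ e
        have ht : t ∈ B := by
          rcases σ with _ | ⟨s', σ⟩
          · rw [(List.cons.inj e).2]; simp
          · rw [(List.cons.inj e).2]; simp
        rw [hdisj t (Or.inr (Or.inl ht))]
        by_contra hlt
        obtain ⟨f, hf, huf⟩ := exists_adj_of_touch (G := G) (e := y) (f := m) (u := t)
          (by have := le1 t; have := le2 s; omega)
        obtain ⟨f', hf', huf'⟩ := exists_adj_of_touch (G := G) (e := y') (f := m') (u := s)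
          (by have := le1 t; have := le2 s; omega)
        exact List.isChain_iff_forall_rel_of_append_cons_cons.1 h.chain_mid e f f' hf hf' huf' huf
      obtain ⟨z, hz⟩ : ∃ z, z ∈ (l :: B).getLast? := ⟨_, List.getLast?_cons⟩
      have := hch.sum_le hz
      have := le2 z
      simp_rw [add_comm (touch G y m _)]
      omega
    have hE : (E.map fun u => touch G y m u + touch G y' m' u).sum ≤
        (E.map c).sum + touch G y m a := by
      have hch : (l' :: E).IsChain fun s t => touch G y m s + touch G y' m' t ≤ c t := by
        rw [List.isChain_iff_forall_rel_of_append_cons_cons]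
        intro s t σ τ e
        have ht : t ∈ E := by
          rcases σ with _ | ⟨s', σ⟩
          · rw [(List.cons.inj e).2]; simp
          · rw [(List.cons.inj e).2]; simp
        rw [hdisj t (Or.inr (Or.inr ht))]
        by_contra hlt
        obtain ⟨f, hf, huf⟩ := exists_adj_of_touch (G := G) (e := y) (f := m) (u := s)
          (by have := le1 s; have := le2 t; omega)
        obtain ⟨f', hf', huf'⟩ := exists_adj_of_touch (G := G) (e := y') (f := m') (u := t)
          (by have := le1 s; have := le2 t; omega)
        exact List.isChain_iff_forall_rel_of_append_cons_cons.1 h.chain_right e f f' hf hf' huf huf'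
      have hl' : a ∈ (l' :: E).getLast? := by
        have h1 := h.walk_right
        obtain ⟨M0, hM0⟩ := h.snd.walk.eq_concat
        rw [hM0, List.append_assoc, List.singleton_append] at h1
        have := h1.2.2
        rwa [List.getLast?_append_of_ne_nil _ (by simp)] at this
      have := hch.sum_le hl'
      omega
    have hLeq := h.eq
    rw [hLeq]
    simp only [List.map_cons, List.sum_cons, List.map_append, List.sum_append]
    rw [hM, hM']
    omega
  rw [edgeDeg_eq_sum, edgeDeg_eq_sum, edgeDeg_eq_sum]
  have hsplit := fun g : V → ℕ => Finset.sum_add_sum_compl (v :: L).toFinset g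
  have h1 := hsplit fun u => touch G k k' u + (touch G y m u + touch G y' m' u)
  have h2 : ∑ u ∈ (v :: L).toFinset, c u + ∑ u ∈ (v :: L).toFinsetᶜ, c u = ∑ u, c u := hsplit c
  have h3 : ∑ u ∈ (v :: L).toFinsetᶜ, (touch G k k' u + (touch G y m u + touch G y' m' u)) ≤
      ∑ u ∈ (v :: L).toFinsetᶜ, c u := by
    refine Finset.sum_le_sum fun u hu => hoff u ?_
    simpa using hu
  rw [← List.sum_toFinset _ hnL, ← List.sum_toFinset c hnL] at hlist
  change _ ≤ ∑ u ∈ (v :: L).toFinset, c u + _ at hlist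
  simp only [Finset.sum_add_distrib] at h1 h3 hlist
  omega

end

theorem exists_walk_of_touch {G : SimpleGraph V} {e f s t : V} (hef : G.Adj e f)
    (hs : touch G e f s = 1) (ht : touch G e f t = 1) :
    ∃ F p q, ListWalk G F p q ∧ G.Adj s p ∧ G.Adj q t ∧ F.Nodup ∧ ∀ z ∈ F, z = e ∨ z = f := by
  obtain ⟨p, hp, hsp⟩ := exists_adj_of_touch (by rw [hs]; simp : touch G e f s ≠ 0)
  obtain ⟨q, hq, htq⟩ := exists_adj_of_touch (by rw [ht]; simp : touch G e f t ≠ 0)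
  by_cases hpq : p = q
  · subst hpq
    exact ⟨[p], p, p, .singleton .., hsp, htq.symm, by simp, by simpa using hp⟩
  · have hadj : G.Adj p q := by
      rcases hp with rfl | rfl <;> rcases hq with rfl | rfl
      · exact absurd rfl hpq
      · exact hef
      · exact hef.symm
      · exact absurd rfl hpq
    refine ⟨[p, q], p, q, (ListWalk.singleton ..).cons hadj, hsp, htq.symm, by simpa using hpq, ?_⟩
    simp only [List.mem_cons, List.not_mem_nil, or_false, forall_eq_or_imp, forall_eq]
    exact ⟨hp, hq⟩

theorem Remote.symm {G : SimpleGraph V} {e f : V × V} (h : Remote G e f) : Remote G f e := by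
  obtain ⟨h1, h2, h3, h4, h5, h6, h7, h8⟩ := h
  rw [G.adj_comm] at h5 h6 h7 h8
  exact ⟨h1.symm, h3.symm, h2.symm, h4.symm, h5, h7, h6, h8⟩

theorem Remote.not_adj {G : SimpleGraph V} {e f : V × V} (h : Remote G e f) {s t : V}
    (hs : s = e.1 ∨ s = e.2) (ht : t = f.1 ∨ t = f.2) : s ≠ t ∧ ¬ G.Adj s t := by
  obtain ⟨h1, h2, h3, h4, h5, h6, h7, h8⟩ := h
  rcases hs with rfl | rfl <;> rcases ht with rfl | rfl <;> tauto

theorem exists_common_neighbor {G : SimpleGraph V} {e f a v b : V} (ha : touch G e f a = 1)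
    (hv : touch G e f v = 1) (hb : touch G e f b = 1) :
    ∃ k, (k = e ∨ k = f) ∧ (G.Adj a k ∧ G.Adj v k ∨
      G.Adj v k ∧ G.Adj b k ∨ G.Adj a k ∧ G.Adj b k) := by
  obtain ⟨p, hp, hap⟩ := exists_adj_of_touch (by rw [ha]; simp : touch G e f a ≠ 0)
  obtain ⟨q, hq, hvq⟩ := exists_adj_of_touch (by rw [hv]; simp : touch G e f v ≠ 0)
  obtain ⟨r, hr, hbr⟩ := exists_adj_of_touch (by rw [hb]; simp : touch G e f b ≠ 0)
  by_cases h1 : p = q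
  · exact ⟨p, hp, Or.inl ⟨hap, h1 ▸ hvq⟩⟩
  by_cases h2 : q = r
  · exact ⟨q, hq, Or.inr (Or.inl ⟨hvq, h2 ▸ hbr⟩)⟩
  have h3 : p = r := by grind
  exact ⟨p, hp, Or.inr (Or.inr ⟨hap, h3 ▸ hbr⟩)⟩

theorem touch_eq_zero_of_remote {G : SimpleGraph V} {e f : V × V} (h : Remote G e f) {z : V}
    (hz : z = e.1 ∨ z = e.2) : touch G f.1 f.2 z = 0 :=
  touch_eq_zero_of_not_adj (h.not_adj hz (Or.inl rfl)).2 (h.not_adj hz (Or.inr rfl)).2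

section

variable [Fintype V] [DecidableEq V] {G : SimpleGraph V} {β : ℝ} {e₀ e₁ e₂ : V × V}
  {a v b x : V}

theorem IsTough.prismHamiltonian_of_common_neighbor (h : IsTough β G) (hβ : 1 < β)
    (hcov : ∀ u, u ∈ [e₀.1, e₀.2, e₁.1, e₁.2, e₂.1, e₂.2, a, v, b, x])
    (hcard : Fintype.card V = 10) (h1 : G.Adj e₁.1 e₁.2)
    (h2 : G.Adj e₂.1 e₂.2) (r01 : Remote G e₀ e₁) (r02 : Remote G e₀ e₂) (r12 : Remote G e₁ e₂)
    {k : V} (hk : k = e₀.1 ∨ k = e₀.2) (hak : G.Adj a k) (hvk : G.Adj v k)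
    (hav : G.Adj a v) (hvb : G.Adj v b)
    (hb : touch G e₁.1 e₁.2 b = 1) (hx1 : touch G e₁.1 e₁.2 x = 1)
    (hx2 : touch G e₂.1 e₂.2 x = 1) (ha : touch G e₂.1 e₂.2 a = 1) : PrismHamiltonian G := by
  have hnd : [e₀.1, e₀.2, e₁.1, e₁.2, e₂.1, e₂.2, a, v, b, x].Nodup := by
    rw [← Multiset.coe_nodup, ← Multiset.toFinset_card_eq_card_iff_nodup]
    have : [e₀.1, e₀.2, e₁.1, e₁.2, e₂.1, e₂.2, a, v, b, x].toFinset = Finset.univ := by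
      ext u; simpa only [List.mem_toFinset, Finset.mem_univ, iff_true] using hcov u
    change (List.toFinset _).card = _
    rw [this, Finset.card_univ, hcard]; rfl
  obtain ⟨F1, p1, q1, w1, bp1, q1x, n1, s1⟩ := exists_walk_of_touch h1 hb hx1
  obtain ⟨F2, p2, q2, w2, xp2, q2a, n2, s2⟩ := exists_walk_of_touch h2 hx2 ha
  simp only [List.nodup_cons, List.mem_cons, List.not_mem_nil, or_false, not_or] at hnd
  have hw : ListWalk G (v :: b :: (F1 ++ (x :: (F2 ++ [a])))) v a :=
    ((w1.append ((w2.concat q2a).cons xp2) q1x).cons bp1).cons hvb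
  have hF1 : ∀ z ∈ F1, z ≠ k ∧ z ≠ a ∧ z ≠ v ∧ z ≠ b ∧ z ≠ x ∧ z ∉ F2 := by
    intro z hz
    have := s1 z hz
    have := s2 z
    grind
  have hF2 : ∀ z ∈ F2, z ≠ k ∧ z ≠ a ∧ z ≠ v ∧ z ≠ b ∧ z ≠ x := by
    intro z hz
    have := s2 z hz
    grind
  have hk' : k ≠ a ∧ k ≠ v ∧ k ≠ b ∧ k ≠ x := by grind
  refine h.prismHamiltonian_of_dominating hβ hw (v := k) ?_ ?_ hav hak hvk.symm ?_
  · simp only [List.nodup_cons, List.nodup_append, List.mem_cons, List.mem_append,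
      List.not_mem_nil, or_false]
    grind
  · simp only [List.mem_cons, List.mem_append, List.not_mem_nil, or_false]
    grind
  · have key : ∀ u, u ∉ k :: (v :: b :: (F1 ++ (x :: (F2 ++ [a])))) →
        ((u = e₀.1 ∨ u = e₀.2) ∧ u ≠ k) ∨ ((u = e₁.1 ∨ u = e₁.2) ∧ u ∉ F1) ∨
        ((u = e₂.1 ∨ u = e₂.2) ∧ u ∉ F2) := by
      intro u hu
      have := hcov u
      simp only [List.mem_cons, List.mem_append, List.not_mem_nil, or_false] at hu this
      grind
    have same : ∀ (e : V × V) (F : List V) (p q : V), ListWalk G F p q →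
        (∀ z ∈ F, z = e.1 ∨ z = e.2) → ∀ s t, (s = e.1 ∨ s = e.2) → s ∉ F →
        (t = e.1 ∨ t = e.2) → t ∉ F → s = t := by
      intro e F p q hF hs s t hse hsF hte htF
      have := hs p hF.left_mem
      have hp := hF.left_mem
      grind
    have hk0 : ∀ s t, (s = e₀.1 ∨ s = e₀.2) → s ≠ k → (t = e₀.1 ∨ t = e₀.2) → t ≠ k → s = t := by
      grind
    intro s t hs ht hst
    rcases key s hs with ⟨g1, g2⟩ | ⟨g1, g2⟩ | ⟨g1, g2⟩ <;>
      rcases key t ht with ⟨g3, g4⟩ | ⟨g3, g4⟩ | ⟨g3, g4⟩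
    · exact hst.ne (hk0 s t g1 g2 g3 g4)
    · exact (r01.not_adj g1 g3).2 hst
    · exact (r02.not_adj g1 g3).2 hst
    · exact (r01.symm.not_adj g1 g3).2 hst
    · exact hst.ne (same e₁ F1 p1 q1 w1 s1 s t g1 g2 g3 g4)
    · exact (r12.not_adj g1 g3).2 hst
    · exact (r02.symm.not_adj g1 g3).2 hst
    · exact (r12.symm.not_adj g1 g3).2 hst
    · exact hst.ne (same e₂ F2 p2 q2 w2 s2 s t g1 g2 g3 g4)

theorem IsTough.prismHamiltonian_of_touch (h : IsTough β G) (hβ : 1 < β)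
    (hcov : ∀ u, u ∈ [e₀.1, e₀.2, e₁.1, e₁.2, e₂.1, e₂.2, a, v, b, x])
    (hcard : Fintype.card V = 10) (h1 : G.Adj e₁.1 e₁.2)
    (h2 : G.Adj e₂.1 e₂.2) (r01 : Remote G e₀ e₁) (r02 : Remote G e₀ e₂) (r12 : Remote G e₁ e₂)
    (hav : G.Adj a v) (hvb : G.Adj v b) (hab : G.Adj a b)
    (ha : touch G e₀.1 e₀.2 a = 1) (hv : touch G e₀.1 e₀.2 v = 1)
    (hb : touch G e₀.1 e₀.2 b = 1) (hx1 : touch G e₁.1 e₁.2 x = 1)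
    (hx2 : touch G e₂.1 e₂.2 x = 1)
    (hT : 5 ≤ touch G e₁.1 e₁.2 a + touch G e₁.1 e₁.2 v + touch G e₁.1 e₁.2 b +
      touch G e₂.1 e₂.2 a + touch G e₂.1 e₂.2 v + touch G e₂.1 e₂.2 b) : PrismHamiltonian G := by
  have core : ∀ {c c' d k : V}, (∀ u, u ∈ [e₀.1, e₀.2, e₁.1, e₁.2, e₂.1, e₂.2, c, c', d, x]) →
      (k = e₀.1 ∨ k = e₀.2) → G.Adj c k → G.Adj c' k → G.Adj c c' → G.Adj c' d →
      (touch G e₁.1 e₁.2 d = 1 ∧ touch G e₂.1 e₂.2 c = 1 ∨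
        touch G e₂.1 e₂.2 d = 1 ∧ touch G e₁.1 e₁.2 c = 1) → PrismHamiltonian G := by
    intro c c' d k hc hk hck hck' hcc hcd hh
    rcases hh with ⟨g1, g2⟩ | ⟨g1, g2⟩
    · exact h.prismHamiltonian_of_common_neighbor hβ hc hcard h1 h2 r01 r02 r12 hk hck hck'
        hcc hcd g1 hx1 hx2 g2
    · refine h.prismHamiltonian_of_common_neighbor hβ (fun u => ?_) hcard h2 h1 r02 r01
        r12.symm hk hck hck' hcc hcd g1 hx2 hx1 g2
      have := hc u
      simp only [List.mem_cons, List.not_mem_nil, or_false] at this ⊢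
      grind
  have t1 := touch_le_one G e₁.1 e₁.2
  have t2 := touch_le_one G e₂.1 e₂.2
  have := t1 a
  have := t1 v
  have := t1 b
  have := t2 a
  have := t2 v
  have := t2 b
  obtain ⟨k, hk, ⟨g1, g2⟩ | ⟨g1, g2⟩ | ⟨g1, g2⟩⟩ := exists_common_neighbor ha hv hb
  · exact core hcov hk g1 g2 hav hvb (by omega)
  · refine core (c := v) (c' := b) (d := a) (fun u => ?_) hk g1 g2 hvb hab.symm (by omega)
    have := hcov u
    simp only [List.mem_cons, List.not_mem_nil, or_false] at this ⊢
    grind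
  · refine core (c := a) (c' := b) (d := v) (fun u => ?_) hk g1 g2 hab hvb.symm (by omega)
    have := hcov u
    simp only [List.mem_cons, List.not_mem_nil, or_false] at this ⊢
    grind

theorem IsTough.prismHamiltonian_of_card_eq_ten (h : IsTough β G) (hβ : 1 < β)
    (hcard : Fintype.card V = 10) (h0 : G.Adj e₀.1 e₀.2) (h1 : G.Adj e₁.1 e₁.2)
    (h2 : G.Adj e₂.1 e₂.2) (r01 : Remote G e₀ e₁) (r02 : Remote G e₀ e₂) (r12 : Remote G e₁ e₂)
    (hav : G.Adj a v) (hvb : G.Adj v b) (hab : G.Adj a b)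
    (hT : ∀ t, t = a ∨ t = v ∨ t = b →
      t ∉ [e₀.1, e₀.2, e₁.1, e₁.2, e₂.1, e₂.2])
    (hdeg : 11 ≤ edgeDeg G e₀.1 e₀.2 + edgeDeg G e₁.1 e₁.2 + edgeDeg G e₂.1 e₂.2) :
    PrismHamiltonian G := by
  set l := [e₀.1, e₀.2, e₁.1, e₁.2, e₂.1, e₂.2, a, v, b] with hl
  have hnd : l.Nodup := by
    obtain ⟨a1, a2, a3, a4, -⟩ := r01
    obtain ⟨b1, b2, b3, b4, -⟩ := r02
    obtain ⟨c1, c2, c3, c4, -⟩ := r12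
    have Ta := hT a (by simp)
    have Tv := hT v (by simp)
    have Tb := hT b (by simp)
    have := h0.ne
    have := h1.ne
    have := h2.ne
    have := hav.ne
    have := hvb.ne
    have := hab.ne
    simp only [List.mem_cons, List.not_mem_nil, or_false, not_or] at Ta Tv Tb
    simp only [hl, List.nodup_cons, List.mem_cons, List.not_mem_nil, or_false, not_or]
    grind
  have hlc : l.toFinset.card = 9 := by rw [List.toFinset_card_of_nodup hnd]; rfl
  obtain ⟨x, hx⟩ : ∃ x, l.toFinsetᶜ = {x} := by
    rw [← Finset.card_eq_one, Finset.card_compl, hcard, hlc]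
  have hxl : ∀ u, u ∈ l ∨ u = x := by
    intro u
    by_cases hu : u ∈ l
    · exact Or.inl hu
    · right
      have : u ∈ l.toFinsetᶜ := by simpa using hu
      rw [hx] at this
      simpa using this
  have hsum : ∀ g : V → ℕ, ∑ u, g u = (l.map g).sum + g x := by
    intro g
    rw [← Finset.sum_add_sum_compl l.toFinset, hx, Finset.sum_singleton, List.sum_toFinset _ hnd]
  rw [edgeDeg_eq_sum, edgeDeg_eq_sum, edgeDeg_eq_sum, hsum, hsum, hsum] at hdeg
  simp only [hl, List.map_cons, List.map_nil, List.sum_cons, List.sum_nil] at hdeg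
  have Z : ∀ e f : V × V, Remote G e f → touch G f.1 f.2 e.1 = 0 ∧ touch G f.1 f.2 e.2 = 0 :=
    fun e f r => ⟨touch_eq_zero_of_remote r (Or.inl rfl), touch_eq_zero_of_remote r (Or.inr rfl)⟩
  have S : ∀ e : V × V, touch G e.1 e.2 e.1 = 0 ∧ touch G e.1 e.2 e.2 = 0 :=
    fun e => ⟨touch_eq_zero_of_mem (Or.inl rfl), touch_eq_zero_of_mem (Or.inr rfl)⟩
  rw [(S e₀).1, (S e₀).2, (S e₁).1, (S e₁).2, (S e₂).1, (S e₂).2, (Z _ _ r01).1, (Z _ _ r01).2,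
    (Z _ _ r02).1, (Z _ _ r02).2, (Z _ _ r12).1, (Z _ _ r12).2, (Z _ _ r01.symm).1,
    (Z _ _ r01.symm).2, (Z _ _ r02.symm).1, (Z _ _ r02.symm).2, (Z _ _ r12.symm).1,
    (Z _ _ r12.symm).2] at hdeg
  have hmem : ∀ u, (u = e₀.1 ∨ u = e₀.2) ∨ (u = e₁.1 ∨ u = e₁.2) ∨ (u = e₂.1 ∨ u = e₂.2) ∨
      u = a ∨ u = v ∨ u = b ∨ u = x := by
    intro u
    have := hxl u
    simp only [hl, List.mem_cons, List.not_mem_nil, or_false] at this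
    grind
  have t0 := touch_le_one G e₀.1 e₀.2
  have t1 := touch_le_one G e₁.1 e₁.2
  have t2 := touch_le_one G e₂.1 e₂.2
  have := t0 a
  have := t0 v
  have := t0 b
  have := t0 x
  have := t1 a
  have := t1 v
  have := t1 b
  have := t1 x
  have := t2 a
  have := t2 v
  have := t2 b
  have := t2 x
  have cases3 : (touch G e₀.1 e₀.2 a + touch G e₀.1 e₀.2 v + touch G e₀.1 e₀.2 b +
      touch G e₁.1 e₁.2 x + touch G e₂.1 e₂.2 x = 5) ∨
      (touch G e₁.1 e₁.2 a + touch G e₁.1 e₁.2 v + touch G e₁.1 e₁.2 b +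
      touch G e₀.1 e₀.2 x + touch G e₂.1 e₂.2 x = 5) ∨
      (touch G e₂.1 e₂.2 a + touch G e₂.1 e₂.2 v + touch G e₂.1 e₂.2 b +
      touch G e₀.1 e₀.2 x + touch G e₁.1 e₁.2 x = 5) := by omega
  rcases cases3 with hh | hh | hh
  · refine h.prismHamiltonian_of_touch (x := x) hβ (fun u => ?_) hcard h1 h2 r01 r02 r12
      hav hvb hab (by omega) (by omega) (by omega) (by omega) (by omega) (by omega)
    have := hmem u
    simp only [List.mem_cons, List.not_mem_nil, or_false]
    grind
  · refine h.prismHamiltonian_of_touch (x := x) hβ (fun u => ?_) hcard h0 h2 r01.symm r12 r02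
      hav hvb hab (by omega) (by omega) (by omega) (by omega) (by omega) (by omega)
    have := hmem u
    simp only [List.mem_cons, List.not_mem_nil, or_false]
    grind
  · refine h.prismHamiltonian_of_touch (x := x) hβ (fun u => ?_) hcard h0 h1 r02.symm r12.symm
      r01 hav hvb hab (by omega) (by omega) (by omega) (by omega) (by omega) (by omega)
    have := hmem u
    simp only [List.mem_cons, List.not_mem_nil, or_false]
    grind

end

theorem ite_le_ite_of_imp {p q : Prop} [Decidable p] [Decidable q] (h : p → q) :
    (if p then 1 else 0) ≤ if q then 1 else 0 := by
  split_ifs <;> simp_all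

theorem ite_add_ite_le_one {p q : Prop} [Decidable p] [Decidable q] (h : ¬ (p ∧ q)) :
    (if p then 1 else 0) + (if q then 1 else 0) ≤ 1 := by
  split_ifs <;> simp_all

theorem ListWalk.eq_singleton {G : SimpleGraph V} {A : List V} {b : V} (h : ListWalk G A b b)
    (hA : A.Nodup) : A = [b] := by
  obtain ⟨t, rfl⟩ := h.eq_cons
  obtain ⟨s, hs⟩ := h.eq_concat
  rcases s with _ | ⟨c, s⟩
  · simpa using hs
  · simp only [List.cons_append, List.cons.injEq] at hs
    rw [hs.2] at hA
    simp at hA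

section

variable {G : SimpleGraph V} {a v b : V} {L : List V} {K : Finset V}
  {x y m l z : V} {A M E : List V}

theorem Spur.ne_apex (h : Spur G v b L K x y m A M E l) (hv : v ∉ L) (hz : z = y ∨ z = m) :
    z ≠ v := by
  rintro rfl
  rcases h.mem_or_of hz with h1 | h1
  · apply hv; rw [h.eq]; simp [h1]
  · simp at h1

theorem Spur.ne_left (h : Spur G v b L K x y m A M E l) (hL : L.Nodup) (hz : z = y ∨ z = m) :
    z ≠ b := by
  rintro rfl
  have hA := h.walk_left.left_mem
  rw [h.eq] at hL
  rcases h.mem_or_of hz with h1 | h1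
  · exact (List.nodup_append.1 hL).2.2 z hA z (by simp [h1]) rfl
  · apply h1; rw [h.eq]; simp [hA]

variable [DecidableEq V]

theorem TriCycle.exists_eq_append (h : TriCycle G a v b L) :
    ∃ R p, L = R ++ [p, a] ∧ ListWalk G (R ++ [p]) b p ∧ p ≠ a ∧ p ≠ b := by
  obtain ⟨t, rfl⟩ := h.walk.eq_concat
  have hlen := h.len
  have ht : t ≠ [] := by rintro rfl; simp at hlen
  obtain ⟨R, p, rfl⟩ := (List.eq_nil_or_concat t).resolve_left ht
  have hn := h.nodup
  have hw := h.walk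
  simp only [List.concat_eq_append, List.append_assoc, List.singleton_append] at hw hn
  have hw' := hw.split_pair.1
  refine ⟨R, p, by simp, hw', ?_, ?_⟩
  · rintro rfl
    simp [List.nodup_append] at hn
  · rintro rfl
    have := hw'.eq_singleton (by
      have : R ++ [p, a] = (R ++ [p]) ++ [a] := by simp
      rw [this] at hn
      exact hn.of_append_left)
    have h1 := congrArg List.length this
    simp only [List.length_append, List.length_singleton] at h1
    obtain rfl : R = [] := List.length_eq_zero_iff.1 (by omega)
    simp at hlen

variable [Fintype V]

theorem TightCycle.exists_pair_of_degree (h : TightCycle G a v b L K)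
    (hconn : ∀ S : Finset V, S.card < 3 → NonSeparating G S)
    (hab : Attached G K a → Attached G K b)
    (hdeg : ∀ e₀ e₁ e₂ : V × V, G.Adj e₀.1 e₀.2 → G.Adj e₁.1 e₁.2 → G.Adj e₂.1 e₂.2 →
      Remote G e₀ e₁ → Remote G e₀ e₂ → Remote G e₁ e₂ → 3 * Fintype.card V ≤
        2 * (edgeDeg G e₀.1 e₀.2 + edgeDeg G e₁.1 e₁.2 + edgeDeg G e₂.1 e₂.2) + 8) :
    ∃ y m M B l x' y' m' M' E l', SpurPair G a v b L K b y m [b] M B l x' y' m' M' E l' ∧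
      a ∉ [y, m, y', m'] ∧ ∀ k ∈ K, ∀ k' ∈ K, G.Adj k k' → Fintype.card V = 10 ∨
        Attached G K a ∧ Attached G K v ∧ touch G y m v = 1 ∧
          ∀ t, t = a ∨ t = v ∨ t = b → touch G k k' t = 1 := by
  classical
  obtain ⟨R, p, hR, hRp, hpa, hpb⟩ := h.exists_eq_append
  have hva := h.adj_av.ne
  have hvb := h.adj_vb.ne
  have hba := h.adj_ab.ne
  have haL := h.walk.right_mem
  have hbL := h.walk.left_mem
  have hpL : p ∈ L := by rw [hR]; simp
  have hpv : p ≠ v := by rintro rfl; exact h.notMem hpL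
  have hap : ¬ (Attached G K a ∧ Attached G K p) := fun hh =>
    h.not_attached_succ (A := R ++ [p]) (B := [a]) (by simp [hR]) hRp (.singleton ..) hh.2 hh.1
  have hvp : ¬ (Attached G K v ∧ Attached G K p) := fun hh =>
    h.not_attached_apex (A := R ++ [p]) (by simp [hR]) hRp hh.2 hh.1
  set N : Finset V := (v :: L).toFinset.filter (Attached G K) with hN
  have hNmem : ∀ u, u ∈ N ↔ u ∈ v :: L ∧ Attached G K u := by intro u; simp [hN]
  have ht3 := h.three_le_card hconn hNmem
  have hinter : ∀ T : Finset V, (∀ u ∈ T, u ∈ v :: L) → N ∩ T = T.filter (Attached G K) := by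
    intro T hT; ext u; simp only [Finset.mem_inter, hNmem, Finset.mem_filter]
    exact ⟨fun hu => ⟨hu.2, hu.1.2⟩, fun hu => ⟨⟨hT u hu.1, hu.2⟩, hu.1⟩⟩
  set α := if Attached G K a then 1 else 0 with hα
  set β := if Attached G K b then 1 else 0 with hβ
  set ν := if Attached G K v then 1 else 0 with hν
  set π := if Attached G K p then 1 else 0 with hπ
  have hαβ : α ≤ β := ite_le_ite_of_imp hab
  have hαπ : α + π ≤ 1 := ite_add_ite_le_one hap
  have hνπ : ν + π ≤ 1 := ite_add_ite_le_one hvp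
  have hβ2 : β ≤ 1 := by rw [hβ]; split_ifs <;> simp
  have hI1 : (N ∩ {a, v, b}).card = α + ν + β := by
    rw [hinter _ (by simp [haL, hbL]), Finset.card_filter, Finset.sum_insert (by simp [hva, hba]),
      Finset.sum_pair hvb, ← add_assoc]
  have hI2 : (N ∩ {a, v, p}).card = α + ν + π := by
    rw [hinter _ (by simp [haL, hpL]), Finset.card_filter,
      Finset.sum_insert (by simp [hva, hpa.symm]), Finset.sum_pair hpv.symm, ← add_assoc]
  have ht1 : 1 + (α + ν + β) ≤ N.card := by
    obtain ⟨x, hx, hxK, hxa, hxb⟩ := h.exists_attached_notMem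
    have hxv : x ≠ v := by rintro rfl; exact h.notMem hx
    rw [← hI1, add_comm, ← Finset.card_insert_of_notMem (a := x) (by simp [hxa, hxb, hxv])]
    exact Finset.card_le_card (Finset.insert_subset ((hNmem x).2 ⟨by simp [hx], hxK⟩)
      Finset.inter_subset_left)
  set D : Finset V := N \ {a, v, p} with hD
  have hDcard : D.card + (α + ν + π) = N.card := by
    rw [← hI2]; exact Finset.card_sdiff_add_card_inter _ _
  have hspur : ∀ x, ∃ y m A M E l, x ∈ D → Spur G v b L K x y m A M E l := by
    intro x
    by_cases hx : x ∈ D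
    · simp only [hD, Finset.mem_sdiff, hNmem, List.mem_cons, Finset.mem_insert,
        Finset.mem_singleton, not_or] at hx
      obtain ⟨⟨hx1, hx2⟩, hx3, hx4, hx5⟩ := hx
      obtain ⟨y, m, A, M, E, l, hs⟩ :=
        h.exists_spur_of_mem hR (hx1.resolve_left hx4) hx5 hx3 hx2
      exact ⟨y, m, A, M, E, l, fun _ => hs⟩
    · exact ⟨x, x, [], [], [], x, fun hx' => absurd hx' hx⟩
  choose y m A M E l hs using hspur
  have hrem : ∀ x ∈ D, ∀ x' ∈ D, x ≠ x' → Remote G (y x, m x) (y x', m x') := by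
    intro x hx x' hx' hne
    rcases (hs x hx).exists_pair h (hs x' hx') hne with ⟨B, hB⟩ | ⟨B, hB⟩
    · exact hB.remote
    · exact hB.remote.symm
  set U : Finset V := D.biUnion fun x => {y x, m x} with hU
  have hUmem : ∀ z, z ∈ U ↔ ∃ x ∈ D, z = y x ∨ z = m x := by intro z; simp [hU]
  have hUcard : U.card = 2 * D.card := by
    rw [hU, Finset.card_biUnion]
    · rw [Finset.sum_congr rfl fun x hx => Finset.card_pair (hs x hx).adj.ne]
      simp [mul_comm]
    · intro x hx x' hx' hne
      refine Finset.disjoint_left.2 fun z hz hz' => ?_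
      simp only [Finset.mem_insert, Finset.mem_singleton] at hz hz'
      exact ((hrem x hx x' hx' hne).not_adj hz hz').1 rfl
  set ω := if a ∈ U then 1 else 0 with hω
  have hUerase : U.card ≤ (U.erase a).card + ω := by
    rw [Finset.card_erase_eq_ite, hω]
    split_ifs <;> omega
  have hW : (N ∪ {a, v, b}).card + (α + ν + β) = N.card + 3 := by
    rw [← hI1, Finset.card_union_add_card_inter]
    congr 1
    exact Finset.card_eq_three.2 ⟨a, v, b, hva, hba, hvb, rfl⟩
  have hωα : a ∈ U → ¬ Attached G K a := by
    intro ha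
    obtain ⟨x, hx, hz⟩ := (hUmem a).1 ha
    exact (hs x hx).not_attached a hz
  have hbound : ∀ k ∈ K, ∀ k' ∈ K, G.Adj k k' →
      (N ∪ {a, v, b}).card + (U.erase a).card + 2 ≤ Fintype.card V := by
    intro k hk k' hk' hkk
    have hWK : ∀ u ∈ N ∪ {a, v, b}, u ∈ v :: L := by
      intro u hu
      simp only [Finset.mem_union, hNmem, Finset.mem_insert, Finset.mem_singleton] at hu
      rcases hu with hu | rfl | rfl | rfl
      · exact hu.1
      all_goals simp [haL, hbL]
    rw [← Finset.card_pair hkk.ne, ← Finset.card_union_of_disjoint, ← Finset.card_union_of_disjoint]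
    · exact Finset.card_le_univ _
    · rw [Finset.disjoint_right]
      intro u hu hu'
      have huK : u ∈ K := by
        simp only [Finset.mem_insert, Finset.mem_singleton] at hu
        rcases hu with rfl | rfl <;> assumption
      rcases Finset.mem_union.1 hu' with hu' | hu'
      · exact h.off u huK (hWK u hu')
      · obtain ⟨x, hx, hz⟩ := (hUmem u).1 (Finset.mem_of_mem_erase hu')
        exact (hs x hx).notMem_of h.off hz huK
    · rw [Finset.disjoint_right]
      intro u hu hu'
      obtain ⟨x, hx, hz⟩ := (hUmem u).1 (Finset.mem_of_mem_erase hu)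
      simp only [Finset.mem_union, hNmem, Finset.mem_insert, Finset.mem_singleton] at hu'
      rcases hu' with hu' | rfl | rfl | rfl
      · exact (hs x hx).not_attached u hz hu'.2
      · simp at hu
      · exact (hs x hx).ne_apex h.notMem hz rfl
      · exact (hs x hx).ne_left h.nodup hz rfl
  have key : ∀ x ∈ D, ∀ x' ∈ D, ∀ B, SpurPair G a v b L K x (y x) (m x) (A x) (M x) B (l x)
      x' (y x') (m x') (M x') (E x') (l x') → ∀ k ∈ K, ∀ k' ∈ K, G.Adj k k' →
      Attached G K b ∧ a ∉ U ∧ (Fintype.card V = 10 ∨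
        Attached G K a ∧ Attached G K v ∧ touch G (y x) (m x) v = 1 ∧
          ∀ t, t = a ∨ t = v ∨ t = b → touch G k k' t = 1) := by
    intro x hx x' hx' B hP k hk k' hk' hkk
    have hle := hP.edgeDeg_add_le hk hk' hkk
    have hd := hdeg (k, k') (y x, m x) (y x', m x') hkk (hs x hx).adj (hs x' hx').adj
      ((hs x hx).remote_inner h hk hk') ((hs x' hx').remote_inner h hk hk') hP.remote
    have hb := hbound k hk k' hk' hkk
    simp only at hd
    have hωτ : a ∈ U → touch G (y x) (m x) a = 0 := by
      intro ha
      obtain ⟨s, hsD, hz⟩ := (hUmem a).1 ha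
      by_cases hsx : s = x
      · subst hsx; exact touch_eq_zero_of_mem hz
      · exact touch_eq_zero_of_remote (hrem s hsD x hx hsx) hz
    have hsum : ∑ u ∈ (v :: L).toFinset, touch G k k' u = ∑ u ∈ N, touch G k k' u := by
      rw [hN, Finset.sum_filter]
      refine Finset.sum_congr rfl fun u _ => ?_
      split_ifs with hu
      · rfl
      · exact touch_eq_zero_of_not_adj (fun h' => hu ⟨k, hk, h'⟩) (fun h' => hu ⟨k', hk', h'⟩)
    have ht0 : ∑ u ∈ N, touch G k k' u ≤ N.card := by
      rw [Finset.card_eq_sum_ones]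
      exact Finset.sum_le_sum fun u _ => touch_le_one ..
    have ht0' : ∀ u ∈ N, touch G k k' u = 0 → ∑ u ∈ N, touch G k k' u + 1 ≤ N.card := by
      intro u hu hu0
      rw [Finset.card_eq_sum_ones]
      exact Finset.sum_lt_sum (fun u _ => touch_le_one ..) ⟨u, hu, by omega⟩
    have τ1 := touch_le_one G (y x) (m x) v
    have τ2 := touch_le_one G (y x') (m x') v
    have τ3 := touch_le_one G (y x') (m x') b
    have τ4 := touch_le_one G (y x) (m x) a
    rw [hsum] at hle
    have hωα' : α + ω ≤ 1 := ite_add_ite_le_one fun hh => hωα hh.2 hh.1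
    have hωτ' : touch G (y x) (m x) a + ω ≤ 1 := by
      rw [hω]
      split_ifs with ha
      · rw [hωτ ha]
      · exact τ4
    have hβ1 : β = 1 := by omega
    have hω0 : ω = 0 := by omega
    have hgb : Attached G K b := by by_contra hg; simp [hβ, hg] at hβ1
    refine ⟨hgb, fun ha => by simp [hω, ha] at hω0, ?_⟩
    by_contra! hcon
    have hα1 : α = 1 := by omega
    have hν1 : ν = 1 := by omega
    have hga : Attached G K a := by by_contra hg; simp [hα, hg] at hα1
    have hgv : Attached G K v := by by_contra hg; simp [hν, hg] at hν1
    obtain ⟨t, ht, htt⟩ := hcon.2 hga hgv (by omega)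
    have htN : t ∈ N := (hNmem t).2 (by
      rcases ht with rfl | rfl | rfl
      · exact ⟨by simp [haL], hga⟩
      · exact ⟨by simp, hgv⟩
      · exact ⟨by simp [hbL], hgb⟩)
    have := touch_le_one G k k' t
    have := ht0' t htN (by omega)
    omega
  obtain ⟨k, hk⟩ := h.nonempty
  obtain ⟨k', hk', hkk⟩ := h.nbr k hk
  have hD2 : 1 < D.card := by omega
  have hb : Attached G K b := by
    obtain ⟨x, hx, x', hx', hne⟩ := Finset.one_lt_card.1 hD2
    rcases (hs x hx).exists_pair h (hs x' hx') hne with ⟨B, hB⟩ | ⟨B, hB⟩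
    · exact (key x hx x' hx' B hB k hk k' hk' hkk).1
    · exact (key x' hx' x hx B hB k hk k' hk' hkk).1
  have hbD : b ∈ D := by
    simp [hD, hNmem, hbL, hb, hba.symm, hvb.symm, hpb.symm]
  obtain ⟨x', hx', hne⟩ := Finset.exists_mem_ne hD2 b
  have hA : A b = [b] := by
    refine (hs b hbD).walk_left.eq_singleton ?_
    have := h.nodup
    rw [(hs b hbD).eq] at this
    exact this.of_append_left
  obtain ⟨B, hB⟩ : ∃ B, SpurPair G a v b L K b (y b) (m b) (A b) (M b) B (l b)
      x' (y x') (m x') (M x') (E x') (l x') := by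
    rcases (hs b hbD).exists_pair h (hs x' hx') hne.symm with hB | ⟨B, hB⟩
    · exact hB
    · exfalso
      have h1 := hB.snd.walk_left.eq_singleton (by
        have := h.nodup
        rw [hB.snd.eq] at this
        exact this.of_append_left)
      have h2 := List.length_pos_iff.2 hB.fst.walk_left.ne_nil
      have h3 := List.length_pos_iff.2 hB.fst.walk.ne_nil
      have h4 := congrArg List.length h1
      simp at h4
      omega
  refine ⟨y b, m b, M b, B, l b, x', y x', m x', M x', E x', l x', hA ▸ hB, ?_, ?_⟩
  · have haU := (key b hbD x' hx' B hB k hk k' hk' hkk).2.1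
    intro ha
    apply haU
    rw [hUmem]
    simp only [List.mem_cons, List.not_mem_nil, or_false] at ha
    rcases ha with ha | ha | ha | ha
    · exact ⟨b, hbD, Or.inl ha⟩
    · exact ⟨b, hbD, Or.inr ha⟩
    · exact ⟨x', hx', Or.inl ha⟩
    · exact ⟨x', hx', Or.inr ha⟩
  · intro k hk k' hk' hkk
    exact (key b hbD x' hx' B hB k hk k' hk' hkk).2.2

end

section

variable {G : SimpleGraph V} {a v b c c' d k : V} {L : List V} {K : Finset V}

theorem ClosedOff.mem_of_isChain {T A : Finset V} (hA : ClosedOff G T A) {X : List V}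
    (hX : X.IsChain G.Adj) (hXT : ∀ z ∈ X, z ∉ T) {u z : V} (hu : u ∈ X) (huA : u ∈ A)
    (hz : z ∈ X) : z ∈ A := by
  have key : (∀ z ∈ X, z ∈ A) ∨ ∀ z ∈ X, z ∉ A := by
    clear hu hz
    induction X with
    | nil => simp
    | cons s X ih =>
      rcases X with _ | ⟨t, X⟩
      · simp only [List.mem_singleton, forall_eq]; exact em _
      · rw [List.isChain_cons_cons] at hX
        have hs := hXT s (by simp)
        have ht := hXT t (by simp)
        rcases ih hX.2 fun z hz => hXT z (by simp [hz]) with h' | h'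
        · refine Or.inl (List.forall_mem_cons.2 ⟨?_, h'⟩)
          exact (hA.2 t (h' t (by simp)) s hX.1.symm).resolve_right hs
        · refine Or.inr (List.forall_mem_cons.2 ⟨fun hsA => ?_, h'⟩)
          exact h' t (by simp) ((hA.2 s hsA t hX.1).resolve_right ht)
  rcases key with h' | h'
  · exact h' z hz
  · exact absurd huA (h' u hu)

variable [Fintype V] [DecidableEq V]

theorem exists_closedOff_of_not_nonSeparating {T : Finset V} (h : ¬ NonSeparating G T) (d : V) :
    ∃ A, ClosedOff G T A ∧ A.Nonempty ∧ d ∉ A := by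
  unfold NonSeparating at h
  push Not at h
  obtain ⟨A, hA, hne, u, huA, huT⟩ := h
  by_cases hdA : d ∈ A
  · exact ⟨_, hA.compl, ⟨u, by simp [huA, huT]⟩, by simp [hdA]⟩
  · exact ⟨A, hA, hne, hdA⟩

theorem exists_nonSeparating_of_adj (hconn : ∀ S : Finset V, S.card < 3 → NonSeparating G S)
    {C : List V} (hoff : ∀ u ∈ K, u ∉ C) (hclosed : ∀ u ∈ K, ∀ w, G.Adj u w → w ∈ K ∨ w ∈ C)
    (hc : c ∈ C) (hc' : c' ∈ C) (hd : d ∈ C) (hdc : d ≠ c) (hdc' : d ≠ c') (hk : k ∈ K)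
    (hA : ∀ A, ClosedOff G {c, c', k} A → d ∉ A → ∀ u ∈ A, u ∉ C)
    (hedge : ∀ s ∈ K, ∀ t ∈ K, G.Adj s t → G.Adj d s ∨ G.Adj d t)
    (hck : G.Adj c k) (hck' : G.Adj c' k) :
    ∃ l ∈ K, G.Adj c l ∧ G.Adj c' l ∧ NonSeparating G {c, c', l} := by
  by_contra! hcon
  have hne : ∀ u ∈ K, ∀ w ∈ C, w ≠ u := by rintro u hu w hw rfl; exact hoff w hu hw
  have hdk := hne k hk d hd
  have small : ∀ s t A, ClosedOff G {s, t} A → A.Nonempty → d ∉ A → d ≠ s → d ≠ t → False := by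
    intro s t A hA hAn hdA h1 h2
    have := hconn {s, t} (Finset.card_le_two.trans_lt (by simp)) A hA hAn d
    simp [hdA, h1, h2] at this
  obtain ⟨A, hAT, hAn, hdA⟩ := exists_closedOff_of_not_nonSeparating (hcon k hk hck hck') d
  have hAC := hA A hAT hdA
  have hdAT : ∀ u ∈ A, ¬ G.Adj d u := by
    intro u hu hdu
    have := hAT.2 u hu d hdu.symm
    simp [hdA, hdc, hdc', hdk] at this
  have hcA : ∀ u ∈ A, u ≠ c ∧ u ≠ c' ∧ u ≠ k := by
    intro u hu
    have := Finset.disjoint_left.1 hAT.1 hu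
    simpa using this
  have hAK : ∀ u ∈ A, u ∈ K := by
    by_contra! hex
    obtain ⟨u, huA, huK⟩ := hex
    refine small c c' (A \ K) ⟨?_, ?_⟩ ⟨u, by simp [huA, huK]⟩ (by simp [hdA]) hdc hdc'
    · rw [Finset.disjoint_left]
      intro z hz
      have := hcA z (Finset.mem_sdiff.1 hz).1
      simp [this]
    · intro z hz w hzw
      rw [Finset.mem_sdiff] at hz
      have hwK : w ∉ K := by
        intro hwK
        rcases hclosed w hwK z hzw.symm with h' | h'
        · exact hz.2 h'
        · exact hAC z hz.1 h'
      have hwk : w ≠ k := by rintro rfl; exact hwK hk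
      have := hAT.2 z hz.1 w hzw
      simp only [Finset.mem_insert, Finset.mem_singleton, Finset.mem_sdiff] at this ⊢
      tauto
  obtain ⟨l, hlA, hlk⟩ : ∃ l ∈ A, G.Adj l k := by
    by_contra! hex
    refine small c c' A ⟨?_, ?_⟩ hAn hdA hdc hdc'
    · rw [Finset.disjoint_left]
      intro z hz
      have := hcA z hz
      simp [this]
    · intro z hz w hzw
      have hwk : w ≠ k := by rintro rfl; exact hex z hz hzw
      have := hAT.2 z hz w hzw
      simp only [Finset.mem_insert, Finset.mem_singleton] at this ⊢
      tauto
  have hlK := hAK l hlA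
  have hdk' : G.Adj d k := (hedge l hlK k hk hlk).resolve_left (hdAT l hlA)
  have hln : ∀ w, G.Adj l w → w = c ∨ w = c' ∨ w = k := by
    intro w hlw
    rcases hAT.2 l hlA w hlw with h' | h'
    · rcases hedge l hlK w (hAK w h') hlw with h'' | h''
      · exact absurd h'' (hdAT l hlA)
      · exact absurd h'' (hdAT w h')
    · simpa using h'
  have hdl := hne l hlK d hd
  have hlne := hcA l hlA
  have hcl : G.Adj c l := by
    by_contra hcl
    refine small c' k {l} ⟨by simp; tauto, ?_⟩ (by simp) (by simpa using hdl) hdc' hdk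
    simp only [Finset.mem_singleton, forall_eq, Finset.mem_insert]
    intro w hlw
    rcases hln w hlw with rfl | h' | h'
    · exact absurd hlw.symm hcl
    all_goals tauto
  have hcl' : G.Adj c' l := by
    by_contra hcl
    refine small c k {l} ⟨by simp; tauto, ?_⟩ (by simp) (by simpa using hdl) hdc hdk
    simp only [Finset.mem_singleton, forall_eq, Finset.mem_insert]
    intro w hlw
    rcases hln w hlw with h' | rfl | h'
    · tauto
    · exact absurd hlw.symm hcl
    · tauto
  obtain ⟨A', hAT', hAn', hdA'⟩ := exists_closedOff_of_not_nonSeparating (hcon l hlK hcl hcl') d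
  have hkA' : k ∉ A' := by
    intro hkA
    have := hAT'.2 k hkA d hdk'.symm
    simp [hdA', hdc, hdc', hdl] at this
  have hcA' : ∀ u ∈ A', u ≠ c ∧ u ≠ c' ∧ u ≠ l := by
    intro u hu
    have := Finset.disjoint_left.1 hAT'.1 hu
    simpa using this
  refine small c c' A' ⟨?_, ?_⟩ hAn' hdA' hdc hdc'
  · rw [Finset.disjoint_left]
    intro z hz
    have := hcA' z hz
    simp [this]
  · intro z hz w hzw
    have hwl : w ≠ l := by
      rintro rfl
      have := hcA' z hz
      rcases hln z hzw.symm with h' | h' | rfl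
      · tauto
      · tauto
      · exact hkA' hz
    have := hAT'.2 z hz w hzw
    simp only [Finset.mem_insert, Finset.mem_singleton] at this ⊢
    tauto

theorem TightCycle.not_adj_apex_of_adj (h : TightCycle G a v b L K)
    (hconn : ∀ S : Finset V, S.card < 3 → NonSeparating G S)
    (hedge : ∀ s ∈ K, ∀ t ∈ K, G.Adj s t → G.Adj b s ∨ G.Adj b t)
    (hk : k ∈ K) (hak : G.Adj a k) : ¬ G.Adj v k := by
  intro hvk
  have haL := h.walk.right_mem
  have hbL := h.walk.left_mem
  have hside : ∀ A, ClosedOff G {a, v, k} A → b ∉ A → ∀ u ∈ A, u ∉ v :: L := by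
    intro A hA hbA u huA huC
    obtain ⟨X, rfl⟩ := h.walk.eq_concat
    have hn := h.nodup
    have hv := h.notMem
    have huT := Finset.disjoint_left.1 hA.1 huA
    simp only [Finset.mem_insert, Finset.mem_singleton, not_or] at huT
    have huX : u ∈ X := by simp at huC; tauto
    have hbX : b ∈ X := by
      have := h.adj_ab.ne.symm
      simp at hbL; tauto
    have hX : X.IsChain G.Adj := by
      have := h.walk.1
      rw [List.isChain_append] at this
      exact this.1
    refine hbA (hA.mem_of_isChain hX ?_ huX huA hbX)
    intro z hz hzT
    simp only [Finset.mem_insert, Finset.mem_singleton] at hzT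
    rcases hzT with rfl | rfl | rfl
    · exact (List.nodup_append.1 hn).2.2 z hz z (by simp) rfl
    · exact hv (by simp [hz])
    · exact h.off _ hk (by simp [hz])
  obtain ⟨l, hl, hal, hvl, hT⟩ := exists_nonSeparating_of_adj hconn (C := v :: L) (d := b) h.off
    h.closed (c := a) (c' := v) (by simp [haL]) (by simp) (by simp [hbL]) h.adj_ab.ne.symm
    h.adj_vb.ne.symm hk hside hedge hak hvk
  refine h.tight a l v (v :: L) ⟨hal, hvl.symm, h.adj_av, h.walk.cons h.adj_vb,
    List.nodup_cons.2 ⟨h.notMem, h.nodup⟩, h.off l hl, ?_, ?_⟩ ⟨l, hl, by simp⟩ ?_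
  · have : ({a, l, v} : Finset V) = {a, v, l} := by ext; simp; tauto
    rw [this]; exact hT
  · have := h.len; simp; omega
  · intro u hu hu'
    exact absurd (List.mem_cons_of_mem l hu) hu'

variable {y m l x' y' m' l' : V} {M B M' E : List V}

theorem SpurPair.not_adj_of_touch
    (h : SpurPair G a v b L K b y m [b] M B l x' y' m' M' E l')
    (hconn : ∀ S : Finset V, S.card < 3 → NonSeparating G S)
    (hedge : ∀ s ∈ K, ∀ t ∈ K, G.Adj s t → G.Adj v s ∨ G.Adj v t) (hay : a ≠ y) (ham : a ≠ m)
    (hv : touch G y m v ≠ 0) (hk : k ∈ K) (hak : G.Adj a k) : ¬ G.Adj b k := by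
  intro hbk
  obtain ⟨f, hf, hvf⟩ := exists_adj_of_touch hv
  have hC := h.cycle
  obtain ⟨F, hF⟩ := h.fst.exists_detour hC.nodup hf
  have haL := hC.walk.right_mem
  have hbL := hC.walk.left_mem
  have hn := hC.nodup
  have heq := h.eq
  have hFa : ∀ z ∈ F, z ≠ a := by
    intro z hz
    rcases hF.sub z hz with rfl | rfl <;> tauto
  have hFv : ∀ z ∈ F, z ≠ v := fun z hz => h.fst.ne_apex hC.notMem (hF.sub z hz)
  have hFb : ∀ z ∈ F, z ≠ b := fun z hz => h.fst.ne_left hn (hF.sub z hz)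
  have hFK : ∀ z ∈ F, z ∉ K := fun z hz => h.fst.notMem_of hC.off (hF.sub z hz)
  have hFM : ∀ z ∈ F, z ∈ M ∨ z ∉ v :: L := fun z hz => h.fst.mem_or_of (hF.sub z hz)
  have hw : ListWalk G (M ++ (B ++ (M' ++ E))) y a := by
    have h1 := hC.walk
    rw [heq] at h1
    obtain ⟨u, w, -, h3, -⟩ := h1.split (by simp) (by simp [h.fst.walk.ne_nil])
    obtain ⟨t, rfl⟩ := h.fst.walk.eq_cons
    obtain rfl : y = w := by simpa using h3.2.1
    exact h3
  have hside : ∀ A, ClosedOff G {a, b, k} A → v ∉ A → ∀ u ∈ A, u ∉ v :: L := by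
    intro A hA hvA u huA huC
    have huT := Finset.disjoint_left.1 hA.1 huA
    simp only [Finset.mem_insert, Finset.mem_singleton, not_or] at huT
    obtain ⟨X, hX⟩ := hw.eq_concat
    rw [List.singleton_append, hX] at heq
    rw [heq] at hn
    have huX : u ∈ X := by
      rw [heq] at huC
      have : u ≠ v := by rintro rfl; exact hvA huA
      simp at huC; tauto
    have hXch : X.IsChain G.Adj := by
      have := hw.1
      rw [hX, List.isChain_append] at this
      exact this.1
    have hlX : l ∈ X := by
      have hlM := h.fst.walk.right_mem
      have h1 : l ∈ X ++ [a] := by rw [← hX]; simp [hlM]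
      have h2 : l ≠ a := by
        rintro rfl
        have h3 := h.walk_right.right_mem
        have h4 := (List.nodup_cons.1 hn).2
        rw [← hX] at h4
        exact (List.nodup_append.1 h4).2.2 l hlM l (List.mem_append_right _ h3) rfl
      simp at h1; tauto
    have hlA : l ∈ A := by
      refine hA.mem_of_isChain hXch ?_ huX huA hlX
      intro z hz hzT
      simp only [Finset.mem_insert, Finset.mem_singleton] at hzT
      rw [List.nodup_cons, List.nodup_append] at hn
      rcases hzT with rfl | rfl | rfl
      · exact hn.2.2.2 z hz z (by simp) rfl
      · exact hn.1 (by simp [hz])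
      · exact hC.off _ hk (by rw [heq]; simp [hz])
    have hfA : f ∈ A := by
      refine hA.mem_of_isChain hF.walk.1 ?_ hF.walk.right_mem hlA hF.walk.left_mem
      intro z hz hzT
      simp only [Finset.mem_insert, Finset.mem_singleton] at hzT
      rcases hzT with rfl | rfl | rfl
      · exact hFa _ hz rfl
      · exact hFb _ hz rfl
      · exact hFK _ hz hk
    have hvk : v ≠ k := by rintro rfl; exact hC.off _ hk (by simp)
    have := hA.2 f hfA v hvf.symm
    simp [hvA, hC.adj_av.ne.symm, hC.adj_vb.ne, hvk] at this
  obtain ⟨l₀, hl, hal, hbl, hT⟩ := exists_nonSeparating_of_adj hconn (C := v :: L) (d := v) hC.off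
    hC.closed (c := a) (c' := b) (by simp [haL]) (by simp [hbL]) (by simp) hC.adj_av.ne.symm
    hC.adj_vb.ne hk hside hedge hak hbk
  generalize B ++ (M' ++ E) = S at hw heq
  have hmem : ∀ z, z ∈ v :: L ↔ z = v ∨ z = b ∨ z ∈ M ∨ z ∈ S := by
    intro z; rw [heq]; simp
  have hlC := hC.off l₀ hl
  rw [hmem] at hlC
  have hn' := hn
  rw [heq] at hn'
  simp only [List.cons_append, List.nil_append, List.nodup_cons] at hn'
  have hnM := List.nodup_append.1 hn'.2
  have hvn := hC.notMem
  rw [heq] at hvn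
  refine hC.tight a l₀ b (b :: v :: (F ++ S))
    ⟨hal, hbl.symm, hC.adj_ab, ?_, ?_, ?_, ?_, ?_⟩ ⟨l₀, hl, by simp⟩ ?_
  · exact ((hw.replace_prefix h.fst.walk hF.walk).cons hvf).cons hC.adj_vb.symm
  · have h1 : b ∉ F := fun hb => hFb b hb rfl
    have h2 : v ∉ F := fun hb => hFv v hb rfl
    have h3 : b ∉ S := fun hb => hn'.1 (List.mem_append_right _ hb)
    have h4 : v ∉ S := fun hb => hvn (by simp only [List.mem_append] at hb ⊢; tauto)
    simp only [List.nodup_cons, List.mem_cons, List.mem_append, List.nodup_append, not_or]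
    refine ⟨⟨hC.adj_vb.ne.symm, h1, h3⟩, ⟨h2, h4⟩, hF.nodup, hnM.2.1, ?_⟩
    · rintro z hz w hw rfl
      rcases hFM z hz with h' | h'
      · exact hnM.2.2 z h' z hw rfl
      · exact h' ((hmem z).2 (by tauto))
  · have := fun hz => hFK l₀ hz hl
    rw [List.mem_cons, List.mem_cons, List.mem_append]
    tauto
  · have : ({a, l₀, b} : Finset V) = {a, b, l₀} := by ext; simp; tauto
    rw [this]; exact hT
  · have := List.length_pos_iff.2 hF.walk.ne_nil
    simp; omega
  · intro u hu hu' w huw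
    rw [hmem] at hu
    have hmem' : ∀ z, z ∈ l₀ :: b :: v :: (F ++ S) ↔ z = l₀ ∨ z = b ∨ z = v ∨ z ∈ F ∨ z ∈ S := by
      intro z; simp
    rw [hmem', not_or, not_or, not_or, not_or] at hu'
    obtain ⟨-, hub, huv, huF, huS⟩ := hu'
    have huM : u ∈ M := by
      rcases hu with hu | hu | hu | hu
      · exact absurd hu huv
      · exact absurd hu hub
      · exact hu
      · exact absurd hu huS
    obtain ⟨rfl, hu2⟩ := hF.skip u huM huF
    have hw' := hu2 w huw
    rw [hmem] at hw'
    rw [hmem']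
    rcases hw' with hw' | hw' | hw' | hw'
    · exact Or.inr (Or.inr (Or.inl hw'))
    · exact Or.inr (Or.inl hw')
    · by_cases hwF : w ∈ F
      · exact Or.inr (Or.inr (Or.inr (Or.inl hwF)))
      · exact absurd (hF.skip w hw' hwF).1 huw.ne.symm
    · exact Or.inr (Or.inr (Or.inr (Or.inr hw')))

end

section

variable [Fintype V] [DecidableEq V] {G : SimpleGraph V} {β : ℝ} {a v b : V} {L : List V}
  {K : Finset V}

theorem TightCycle.prismHamiltonian_of_attached (h : TightCycle G a v b L K)
    (hG : IsTough β G) (hβ : 1 < β) (hconn : ∀ S : Finset V, S.card < 3 → NonSeparating G S)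
    (hdeg : ∀ e₀ e₁ e₂ : V × V, G.Adj e₀.1 e₀.2 → G.Adj e₁.1 e₁.2 → G.Adj e₂.1 e₂.2 →
      Remote G e₀ e₁ → Remote G e₀ e₂ → Remote G e₁ e₂ → 3 * Fintype.card V ≤
        2 * (edgeDeg G e₀.1 e₀.2 + edgeDeg G e₁.1 e₁.2 + edgeDeg G e₂.1 e₂.2) + 8)
    (hab : Attached G K a → Attached G K b) : PrismHamiltonian G := by
  obtain ⟨y, m, M, B, l, x', y', m', M', E, l', hP, ha, hK⟩ :=
    h.exists_pair_of_degree hconn hab hdeg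
  simp only [List.mem_cons, List.not_mem_nil, or_false, not_or] at ha
  obtain ⟨k, hk⟩ := h.nonempty
  obtain ⟨k', hk', hkk⟩ := h.nbr k hk
  by_cases hcard : Fintype.card V = 10
  · have r1 := hP.fst.remote_inner h hk hk'
    have r2 := hP.snd.remote_inner h hk hk'
    have hd := hdeg (k, k') (y, m) (y', m') hkk hP.fst.adj hP.snd.adj r1 r2 hP.remote
    refine hG.prismHamiltonian_of_card_eq_ten hβ hcard (e₀ := (k, k')) (e₁ := (y, m))
      (e₂ := (y', m')) hkk hP.fst.adj hP.snd.adj r1 r2 hP.remote h.adj_av h.adj_vb h.adj_ab ?_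
      (by omega)
    intro t ht htm
    have htC : t ∈ v :: L := by
      rcases ht with rfl | rfl | rfl <;> simp [h.walk.left_mem, h.walk.right_mem]
    simp only [List.mem_cons, List.not_mem_nil, or_false] at htm
    have htK : (t = y ∨ t = m) ∨ t = y' ∨ t = m' := by
      rcases htm with rfl | rfl | htm
      · exact absurd htC (h.off _ hk)
      · exact absurd htC (h.off _ hk')
      · tauto
    rcases ht with rfl | rfl | rfl
    · tauto
    · rcases htK with h' | h'
      · exact hP.fst.ne_apex h.notMem h' rfl
      · exact hP.snd.ne_apex h.notMem h' rfl
    · rcases htK with h' | h'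
      · exact hP.fst.ne_left h.nodup h' rfl
      · exact hP.snd.ne_left h.nodup h' rfl
  · exfalso
    have hT := fun s hs s' hs' hss => (hK s hs s' hs' hss).resolve_left hcard
    have hedge : ∀ t, t = a ∨ t = v ∨ t = b → ∀ s ∈ K, ∀ s' ∈ K, G.Adj s s' →
        G.Adj t s ∨ G.Adj t s' := by
      intro t ht s hs s' hs' hss
      obtain ⟨z, rfl | rfl, hz⟩ := exists_adj_of_touch (G := G) (e := s) (f := s') (u := t)
        (by rw [(hT s hs s' hs' hss).2.2.2 t ht]; simp)
      · exact Or.inl hz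
      · exact Or.inr hz
    obtain ⟨-, -, hv, ht⟩ := hT k hk k' hk' hkk
    obtain ⟨c, hc, hcT⟩ := exists_common_neighbor (ht a (by simp)) (ht v (by simp)) (ht b (by simp))
    have hcK : c ∈ K := by rcases hc with rfl | rfl <;> assumption
    rcases hcT with ⟨h1, h2⟩ | ⟨h1, h2⟩ | ⟨h1, h2⟩
    · exact h.not_adj_apex_of_adj hconn (hedge b (by simp)) hcK h1 h2
    · exact h.reverse.not_adj_apex_of_adj hconn (hedge a (by simp)) hcK h2 h1
    · exact hP.not_adj_of_touch hconn (hedge v (by simp)) ha.1 ha.2.1 (by simp [hv]) hcK h1 h2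

end

/-- Every `(1+ε)`-tough, 3-connected, 5-chordal graph in which every 3 mutually
remote edges `e₁, e₂, e₃` satisfy `d(e₁) + d(e₂) + d(e₃) > (3/2)(|V(G)| - 3)` is
prism-Hamiltonian. -/
theorem prism_hamiltonian_of_tough_fiveChordal_three_remote_edges
    [Fintype V] [DecidableEq V] (ε : ℝ) (hε : 0 < ε) (G : SimpleGraph V)
    (htough : IsTough (1 + ε) G) (hchordal : FiveChordal G)
    (hconn : KConnected 3 G)
    (hdeg : ∀ e₁ e₂ e₃ : V × V,
      G.Adj e₁.1 e₁.2 → G.Adj e₂.1 e₂.2 → G.Adj e₃.1 e₃.2 →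
      Remote G e₁ e₂ → Remote G e₁ e₃ → Remote G e₂ e₃ →
      (3 / 2 : ℝ) * (Fintype.card V - 3) <
        (edgeDeg G e₁.1 e₁.2 : ℝ) + (edgeDeg G e₂.1 e₂.2 : ℝ) + (edgeDeg G e₃.1 e₃.2 : ℝ)) :
    PrismHamiltonian G := by
  have hβ : 1 < 1 + ε := by linarith
  have hns : ∀ S : Finset V, S.card < 3 → NonSeparating G S := fun S hS => hconn.nonSeparating hS
  have hdeg' : ∀ e₀ e₁ e₂ : V × V, G.Adj e₀.1 e₀.2 → G.Adj e₁.1 e₁.2 → G.Adj e₂.1 e₂.2 →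
      Remote G e₀ e₁ → Remote G e₀ e₂ → Remote G e₁ e₂ → 3 * Fintype.card V ≤
        2 * (edgeDeg G e₀.1 e₀.2 + edgeDeg G e₁.1 e₁.2 + edgeDeg G e₂.1 e₂.2) + 8 := by
    intro e₀ e₁ e₂ h0 h1 h2 h3 h4 h5
    have h := hdeg e₀ e₁ e₂ h0 h1 h2 h3 h4 h5
    have h' : ((3 * Fintype.card V : ℕ) : ℝ) <
        ((2 * (edgeDeg G e₀.1 e₀.2 + edgeDeg G e₁.1 e₁.2 + edgeDeg G e₂.1 e₂.2) + 9 : ℕ) : ℝ) := by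
      push_cast; linarith
    have := Nat.cast_lt.1 h'
    omega
  obtain ⟨m, x, hm, he⟩ := htough.exists_odd_closed hβ hconn.1.le
  obtain ⟨p, -, q, -, r, -, hpq, hqr, hpr⟩ := hchordal.exists_triangle hm he
  obtain ⟨a, v, b, hav, hvb, hab, hT⟩ := hchordal.exists_nonSeparating_triangle hns hpq hqr hpr
  obtain ⟨a, v, b, L, hL, hdom | ⟨K, hK⟩⟩ := TriCycle.exists_dominating_or_tight
    ⟨a, v, b, exists_triCycle hns hconn.1 hav hvb hab hT⟩
  · exact htough.prismHamiltonian_of_dominating hβ hL.walk hL.nodup hL.notMem hL.adj_ab hL.adj_av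
      hL.adj_vb hdom
  · by_cases hab : Attached G K a → Attached G K b
    · exact hK.prismHamiltonian_of_attached htough hβ hns hdeg' hab
    · exact hK.reverse.prismHamiltonian_of_attached htough hβ hns hdeg' (by tauto)
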